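/- arXiv:2201.11471 — 4 statements merged into one kernel-verified Lean document; each statement's English description precedes it below -/
import Mathlib

section
/- If m and n are coprime odd positive integers and k is any integer, then G_k(m) · G_k(n) = G_k(mn). -/
open scoped Real

/-- `e(x) = e^{2πix}`. -/
noncomputable def eC (x : ℝ) : ℂ := Complex.exp (2 * Real.pi * Complex.I * x)

/-- `τ_k(n) = Σ_{b mod n} (b/n) e(bk/n)`, where `(·/n)` is the Jacobi symbol. -/
noncomputable def tauG (k : ℤ) (n : ℕ) : ℂ :=
  ∑ b ∈ Finset.range n, (jacobiSym b n : ℂ) * eC (b * k / n)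

/-- `G_k(n) = ((1−i)/2 + (−1/n)·(1+i)/2)·τ_k(n)`. -/
noncomputable def GaussG (k : ℤ) (n : ℕ) : ℂ :=
  ((1 - Complex.I) / 2 + (jacobiSym (-1) n : ℂ) * (1 + Complex.I) / 2) * tauG k n

theorem eC_add (x y : ℝ) : eC (x + y) = eC x * eC y := by
  rw [eC, eC, eC, ← Complex.exp_add]
  push_cast
  ring_nf

theorem eC_intCast (z : ℤ) : eC z = 1 := by
  rw [eC, Complex.exp_eq_one_iff]
  exact ⟨z, by push_cast; ring⟩

/-- The summand of `τ_k(n)` is periodic modulo `n`. -/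
theorem tauG_summand_mod (k : ℤ) {n : ℕ} (hn : 0 < n) (c : ℕ) :
    (jacobiSym (c % n : ℕ) n : ℂ) * eC ((c % n : ℕ) * k / n) =
      (jacobiSym c n : ℂ) * eC (c * k / n) := by
  have hn' : (n : ℝ) ≠ 0 := by positivity
  have hJ : jacobiSym (c % n : ℕ) n = jacobiSym c n := by
    rw [Int.natCast_mod, ← jacobiSym.mod_left]
  have hc : (c : ℝ) = (c % n : ℕ) + n * (c / n : ℕ) := by
    exact_mod_cast (Nat.mod_add_div c n).symm
  have he : (c : ℝ) * k / n = (c % n : ℕ) * k / n + (((c / n : ℕ) * k : ℤ) : ℝ) := by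
    rw [hc, Int.cast_mul, Int.cast_natCast]
    field_simp
  rw [hJ, he, eC_add, eC_intCast, mul_one]

/-- The Chinese remainder parametrisation `(a, b) ↦ an + bm` of the residues modulo `mn`. -/
theorem injOn_mul_add_mul_mod {m n : ℕ} (hcop : Nat.Coprime m n) :
    Set.InjOn (fun p : ℕ × ℕ => (p.1 * n + p.2 * m) % (m * n))
      (Finset.range m ×ˢ Finset.range n : Finset (ℕ × ℕ)) := by
  rintro ⟨a, b⟩ hab ⟨a', b'⟩ hab' h
  simp only [Finset.coe_product, Finset.coe_range, Set.mem_prod, Set.mem_Iio] at hab hab'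
  have h : a * n + b * m ≡ a' * n + b' * m [MOD m * n] := h
  have h₁ : a * n ≡ a' * n [MOD m] := by
    simpa [Nat.ModEq] using h.of_mul_right n
  have h₂ : b * m ≡ b' * m [MOD n] := by
    simpa [Nat.ModEq] using h.of_mul_left m
  have ha : a = a' :=
    (Nat.ModEq.cancel_right_of_coprime hcop h₁).eq_of_lt_of_lt hab.1 hab'.1
  have hb : b = b' :=
    (Nat.ModEq.cancel_right_of_coprime hcop.symm h₂).eq_of_lt_of_lt hab.2 hab'.2
  rw [ha, hb]

theorem image_mul_add_mul_mod {m n : ℕ} (hm : 0 < m) (hn : 0 < n) (hcop : Nat.Coprime m n) :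
    (Finset.range m ×ˢ Finset.range n).image
      (fun p : ℕ × ℕ => (p.1 * n + p.2 * m) % (m * n)) = Finset.range (m * n) := by
  refine Finset.eq_of_subset_of_card_le ?_ ?_
  · intro c hc
    obtain ⟨p, -, rfl⟩ := Finset.mem_image.mp hc
    exact Finset.mem_range.mpr (Nat.mod_lt _ (Nat.mul_pos hm hn))
  · rw [Finset.card_image_of_injOn (injOn_mul_add_mul_mod hcop)]
    simp

/-- Twisted multiplicativity of `τ_k`. -/
theorem tauG_mul {m n : ℕ} (hm : 0 < m) (hn : 0 < n) (hcop : Nat.Coprime m n) (k : ℤ) :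
    tauG k (m * n) =
      (jacobiSym n m : ℂ) * (jacobiSym m n : ℂ) * (tauG k m * tauG k n) := by
  have hm' : (m : ℝ) ≠ 0 := by positivity
  have hn' : (n : ℝ) ≠ 0 := by positivity
  rw [tauG, ← image_mul_add_mul_mod hm hn hcop, Finset.sum_image (injOn_mul_add_mul_mod hcop),
    tauG, tauG, Finset.sum_mul_sum, ← Finset.sum_product', Finset.mul_sum]
  refine Finset.sum_congr rfl ?_
  rintro ⟨a, b⟩ -
  rw [tauG_summand_mod k (Nat.mul_pos hm hn)]
  have hJm : jacobiSym (a * n + b * m : ℕ) m = jacobiSym a m * jacobiSym n m := by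
    rw [← jacobiSym.mul_left]
    exact jacobiSym.mod_left' (by push_cast; simp)
  have hJn : jacobiSym (a * n + b * m : ℕ) n = jacobiSym b n * jacobiSym m n := by
    rw [← jacobiSym.mul_left]
    exact jacobiSym.mod_left' (by push_cast; simp)
  have he : ((a * n + b * m : ℕ) : ℝ) * k / (m * n : ℕ) = a * k / m + b * k / n := by
    push_cast
    field_simp
  rw [jacobiSym.mul_right' _ hm.ne' hn.ne', hJm, hJn, he, eC_add]
  push_cast
  ring

/-- Quadratic reciprocity, phrased through the normalising factor of `G_k`. -/
theorem gaussG_factor_mul {m n : ℕ} (hmo : Odd m) (hno : Odd n) (hcop : Nat.Coprime m n) :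
    ((1 - Complex.I) / 2 + (jacobiSym (-1) m : ℂ) * (1 + Complex.I) / 2) *
        ((1 - Complex.I) / 2 + (jacobiSym (-1) n : ℂ) * (1 + Complex.I) / 2) =
      ((1 - Complex.I) / 2 + (jacobiSym (-1) (m * n) : ℂ) * (1 + Complex.I) / 2) *
        ((jacobiSym n m : ℂ) * (jacobiSym m n : ℂ)) := by
  have hsq : (jacobiSym m n : ℂ) * (jacobiSym m n : ℂ) = 1 := by
    have := jacobiSym.sq_one (a := m) (b := n) (by simpa using hcop)
    rw [← sq]
    exact_mod_cast this
  have hI : Complex.I ^ 2 = -1 := Complex.I_sq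
  have one_of {b : ℕ} (hb : b % 4 = 1) : jacobiSym (-1) b = 1 := by
    rw [jacobiSym.at_neg_one (Nat.odd_iff.mpr (by lia)), ZMod.χ₄_nat_one_mod_four hb]
  have neg_one_of {b : ℕ} (hb : b % 4 = 3) : jacobiSym (-1) b = -1 := by
    rw [jacobiSym.at_neg_one (Nat.odd_iff.mpr (by lia)), ZMod.χ₄_nat_three_mod_four hb]
  rw [jacobiSym.mul_right' _ hmo.pos.ne' hno.pos.ne']
  rcases Nat.odd_mod_four_iff.mp (Nat.odd_iff.mp hmo) with h₁ | h₁
  · rw [← jacobiSym.quadratic_reciprocity_one_mod_four h₁ hno, hsq, one_of h₁]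
    push_cast
    ring
  · rcases Nat.odd_mod_four_iff.mp (Nat.odd_iff.mp hno) with h₂ | h₂
    · rw [jacobiSym.quadratic_reciprocity_one_mod_four h₂ hmo, hsq, one_of h₂]
      push_cast
      ring
    · rw [jacobiSym.quadratic_reciprocity_three_mod_four h₂ h₁, neg_one_of h₁, neg_one_of h₂]
      push_cast
      linear_combination hI + hsq

/-- If `m` and `n` are coprime odd positive integers and `k` is any integer,
then `G_k(m)·G_k(n) = G_k(mn)`. -/
theorem stmt_6 (m n : ℕ) (hm : 0 < m) (hn : 0 < n) (hmo : Odd m) (hno : Odd n)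
    (hcop : Nat.Coprime m n) (k : ℤ) :
    GaussG k m * GaussG k n = GaussG k (m * n) := by
  rw [GaussG, GaussG, GaussG, tauG_mul hm hn hcop, mul_mul_mul_comm,
    gaussG_factor_mul hmo hno hcop, mul_assoc]
end

section
/- For j ∈ {1, 2}, the function ω_j is smooth on (0, ∞), and for every positive integer ν there is a constant C (depending only on ν and j) such that |ω_j^{(ν)}(ξ)| ≤ C · ξ^{2ν+2} · exp(−j·ξ^{2/j}) for all ξ ≥ 1; in particular |ω_j^{(ν)}(ξ)| ≤ C' · exp(−(j/2)·ξ^{2/j}) for all ξ ≥ 1 for some constant C' depending only on ν and j. -/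
open scoped Real

/-- `ω_j(ξ) = (1/(2πi)) ∫_{(c)} (Γ(s/2 + 1/4)/Γ(1/4))^j ξ^{−s} ds/s`, the integral taken over
the vertical line `Re s = c` (here instantiated at `c = 1`; the value is independent of the
choice of `c > 0`), parametrised as `s = 1 + it`, `ds = i dt`. -/
noncomputable def omegaJ (j : ℕ) (ξ : ℝ) : ℂ :=
  (1 / (2 * Real.pi)) * ∫ t : ℝ,
    (Complex.Gamma ((1 + t * Complex.I) / 2 + 1 / 4) / Complex.Gamma (1 / 4)) ^ j *
      (ξ : ℂ) ^ (-(1 + t * Complex.I)) / (1 + t * Complex.I)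

open Set Filter Topology MeasureTheory

section DerivativeFamily

variable {ι E : Type*} [NormedAddCommGroup E] [NormedSpace ℝ E]
  {f : ι → ℝ → E} {a b : ι → ℝ} {u v : ι → ι}

/-- A family of functions on `(0, ∞)` which is stable under differentiation, up to
two-term linear combinations, consists of smooth functions. -/
theorem contDiffOn_of_deriv_stable
    (hd : ∀ i, ∀ x, 0 < x → HasDerivAt (f i) (a i • f (u i) x + b i • f (v i) x) x) (i : ι) :
    ContDiffOn ℝ (⊤ : ℕ∞) (f i) (Ioi 0) := by
  refine contDiffOn_infty.2 fun n => ?_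
  induction n generalizing i with
  | zero =>
    exact contDiffOn_zero.2 fun x hx => (hd i x hx).continuousAt.continuousWithinAt
  | succ n ih =>
    push_cast
    refine (contDiffOn_succ_iff_deriv_of_isOpen isOpen_Ioi).2
      ⟨fun x hx => (hd i x hx).differentiableAt.differentiableWithinAt, by simp, ?_⟩
    refine (((ih (u i)).const_smul (a i)).add ((ih (v i)).const_smul (b i))).congr ?_
    intro x hx
    exact (hd i x hx).deriv

/-- In a family stable under differentiation where one derivative raises the degree by at most
one, `n` derivatives raise the degree of the bound on `[1, ∞)` by at most `n`. -/
theorem exists_norm_iteratedDeriv_le_of_deriv_stable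
    (hd : ∀ i, ∀ x, 0 < x → HasDerivAt (f i) (a i • f (u i) x + b i • f (v i) x) x)
    {d : ι → ℝ} {w : ℝ → ℝ} (hw : ∀ x, 0 ≤ w x)
    (hu : ∀ i, d (u i) ≤ d i + 1) (hv : ∀ i, d (v i) ≤ d i + 1)
    (hf : ∀ i, ∃ C, 0 ≤ C ∧ ∀ x, 1 ≤ x → ‖f i x‖ ≤ C * x ^ d i * w x) (n : ℕ) (i : ι) :
    ∃ C, 0 ≤ C ∧ ∀ x, 1 ≤ x → ‖iteratedDeriv n (f i) x‖ ≤ C * x ^ (d i + n) * w x := by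
  induction n generalizing i with
  | zero => simpa using hf i
  | succ n ih =>
    obtain ⟨A, hA, hA'⟩ := ih (u i)
    obtain ⟨B, hB, hB'⟩ := ih (v i)
    refine ⟨|a i| * A + |b i| * B, by positivity, fun x hx => ?_⟩
    have hx0 : 0 < x := by linarith
    have hsm : ∀ k, ContDiffAt ℝ n (f k) x := fun k =>
      ((contDiffOn_of_deriv_stable hd k).contDiffAt (Ioi_mem_nhds hx0)).of_le
        (by exact_mod_cast le_top)
    have heq : deriv (f i) =ᶠ[𝓝 x] a i • f (u i) + b i • f (v i) := by
      filter_upwards [Ioi_mem_nhds hx0] with y hy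
      exact (hd i y hy).deriv
    rw [iteratedDeriv_succ', heq.iteratedDeriv_eq,
      iteratedDeriv_add (f := a i • f (u i)) (g := b i • f (v i))
        ((hsm _).const_smul _) ((hsm _).const_smul _),
      iteratedDeriv_const_smul_field, iteratedDeriv_const_smul_field]
    have hmono : ∀ k, d k ≤ d i + 1 → x ^ (d k + n) ≤ x ^ (d i + ((n + 1 : ℕ) : ℝ)) :=
      fun k hk => Real.rpow_le_rpow_of_exponent_le hx (by push_cast; linarith)
    have := hw x
    calc _ ≤ |a i| * ‖iteratedDeriv n (f (u i)) x‖ + |b i| * ‖iteratedDeriv n (f (v i)) x‖ := by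
          refine (norm_add_le _ _).trans_eq ?_
          simp [norm_smul]
      _ ≤ |a i| * (A * x ^ (d i + ((n + 1 : ℕ) : ℝ)) * w x)
          + |b i| * (B * x ^ (d i + ((n + 1 : ℕ) : ℝ)) * w x) := by
          gcongr
          · exact (hA' x hx).trans
              (mul_le_mul_of_nonneg_right (mul_le_mul_of_nonneg_left (hmono _ (hu i)) hA) this)
          · exact (hB' x hx).trans
              (mul_le_mul_of_nonneg_right (mul_le_mul_of_nonneg_left (hmono _ (hv i)) hB) this)
      _ = _ := by ring

end DerivativeFamily

section GammaDecay

theorem norm_Gamma_le_Gamma_re {z : ℂ} (hz : 0 < z.re) : ‖Complex.Gamma z‖ ≤ Real.Gamma z.re := by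
  rw [Complex.Gamma_eq_integral hz, Real.Gamma_eq_integral hz, Complex.GammaIntegral]
  refine (norm_integral_le_integral_norm _).trans_eq ?_
  refine setIntegral_congr_fun measurableSet_Ioi fun x hx => ?_
  simp only [norm_mul, Complex.norm_cpow_eq_rpow_re_of_pos hx, Complex.norm_real,
    Real.norm_eq_abs, Real.abs_exp, Complex.sub_re, Complex.one_re]

theorem norm_Gamma_three_quarters_add_le (t : ℝ) :
    ‖Complex.Gamma ((1 + t * Complex.I) / 2 + 1 / 4)‖ ≤
      4 * Real.Gamma (11 / 4) * (1 + t ^ 2)⁻¹ := by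
  set z : ℂ := (1 + t * Complex.I) / 2 + 1 / 4 with hz
  have hre : z.re = 3 / 4 := by simp [hz]; norm_num
  have him : z.im = t / 2 := by simp [hz]
  have hz0 : z ≠ 0 := fun h => by norm_num [h] at hre
  have hz1 : z + 1 ≠ 0 := fun h => by
    have := congrArg Complex.re h
    simp [hre] at this
    norm_num at this
  have h2 : Complex.Gamma (z + 1 + 1) = (z + 1) * (z * Complex.Gamma z) := by
    rw [Complex.Gamma_add_one _ hz1, Complex.Gamma_add_one _ hz0]
  have hG : ‖Complex.Gamma (z + 1 + 1)‖ ≤ Real.Gamma (11 / 4) := by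
    have : (z + 1 + 1).re = 11 / 4 := by simp [hre]; norm_num
    simpa only [this] using norm_Gamma_le_Gamma_re (z := z + 1 + 1) (by rw [this]; norm_num)
  have hzsq : ‖z‖ ^ 2 = 9 / 16 + t ^ 2 / 4 := by
    rw [← Complex.normSq_eq_norm_sq, Complex.normSq_apply, hre, him]; ring
  have hz1sq : ‖z + 1‖ ^ 2 = 49 / 16 + t ^ 2 / 4 := by
    rw [← Complex.normSq_eq_norm_sq, Complex.normSq_apply]
    simp only [Complex.add_re, Complex.add_im, hre, him, Complex.one_re, Complex.one_im]; ring
  have hle : ‖z‖ ≤ ‖z + 1‖ := by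
    refine le_of_sq_le_sq ?_ (norm_nonneg _)
    rw [hzsq, hz1sq]; linarith
  have hprod : (1 + t ^ 2) / 4 ≤ ‖z + 1‖ * ‖z‖ := by
    nlinarith [norm_nonneg z]
  rw [h2, norm_mul, norm_mul, ← mul_assoc] at hG
  rw [← div_eq_mul_inv, le_div_iff₀ (by positivity)]
  nlinarith [norm_nonneg (Complex.Gamma z),
    mul_le_mul_of_nonneg_right hprod (norm_nonneg (Complex.Gamma z))]

theorem continuous_Gamma_three_quarters_add :
    Continuous fun t : ℝ => Complex.Gamma ((1 + t * Complex.I) / 2 + 1 / 4) := by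
  refine continuous_iff_continuousAt.2 fun t => ?_
  refine ContinuousAt.comp (g := Complex.Gamma) (f := fun t : ℝ => (1 + t * Complex.I) / 2 + 1 / 4)
    (Complex.differentiableAt_Gamma _ fun m h => ?_).continuousAt (by fun_prop)
  have := congrArg Complex.re h
  simp at this
  have hm : (0 : ℝ) ≤ m := m.cast_nonneg
  norm_num at this
  linarith

/-- The `j`-th power of the normalised Gamma factor decays at least quadratically. -/
theorem exists_norm_Gamma_ratio_pow_le {j : ℕ} (hj : 1 ≤ j) :
    ∃ C : ℝ, ∀ t : ℝ,
      ‖(Complex.Gamma ((1 + t * Complex.I) / 2 + 1 / 4) / Complex.Gamma (1 / 4)) ^ j‖ ≤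
        C * (1 + t ^ 2)⁻¹ := by
  refine ⟨(4 * Real.Gamma (11 / 4) / ‖Complex.Gamma (1 / 4)‖) ^ j, fun t => ?_⟩
  have hΓ : 0 < Real.Gamma (11 / 4) := Real.Gamma_pos_of_pos (by norm_num)
  have h1 : (1 + t ^ 2)⁻¹ ≤ 1 := inv_le_one_of_one_le₀ (by nlinarith)
  rw [norm_pow, norm_div]
  calc _ ≤ (4 * Real.Gamma (11 / 4) / ‖Complex.Gamma (1 / 4)‖ * (1 + t ^ 2)⁻¹) ^ j := by
        gcongr
        rw [div_mul_eq_mul_div]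
        gcongr
        exact norm_Gamma_three_quarters_add_le t
    _ ≤ _ := by
        rw [mul_pow]
        gcongr
        exact pow_le_of_le_one (by positivity) h1 (by omega)

end GammaDecay

section Derivative

variable {j : ℕ} {k : ℝ → ℂ} {c : ℂ}

theorem hasDerivAt_omegaJ_mellinInv (hj : 1 ≤ j) {ξ : ℝ} (hξ : 0 < ξ) :
    HasDerivAt (omegaJ j)
      (-(ξ : ℂ)⁻¹ * mellinInv 1
        (fun s => (Complex.Gamma (s / 2 + 1 / 4) / Complex.Gamma (1 / 4)) ^ j) ξ) ξ := by
  obtain ⟨C, hC⟩ := exists_norm_Gamma_ratio_pow_le hj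
  set G : ℝ → ℂ := fun t =>
    (Complex.Gamma ((1 + t * Complex.I) / 2 + 1 / 4) / Complex.Gamma (1 / 4)) ^ j with hG
  have hGc : Continuous G := (continuous_Gamma_three_quarters_add.div_const _).pow j
  have hs0 : ∀ t : ℝ, (1 + t * Complex.I) ≠ 0 := fun t h => by
    simpa using congrArg Complex.re h
  have hs1 : ∀ t : ℝ, 1 ≤ ‖1 + t * Complex.I‖ := fun t => by
    simpa using Complex.abs_re_le_norm (1 + t * Complex.I)
  have hcont : ∀ x : ℝ, 0 < x → Continuous fun t : ℝ =>
      G t * (x : ℂ) ^ (-(1 + t * Complex.I)) / (1 + t * Complex.I) := fun x hx =>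
    (hGc.mul (Continuous.const_cpow (by fun_prop) (Or.inl (by exact_mod_cast hx.ne')))).div
      (by fun_prop) hs0
  have hnorm : ∀ x : ℝ, 0 < x → ∀ t : ℝ, ‖(x : ℂ) ^ (-(1 + t * Complex.I))‖ = x⁻¹ :=
    fun x hx t => by
      rw [Complex.norm_cpow_eq_rpow_re_of_pos hx]
      simp [Real.rpow_neg_one]
  have hnorm' : ∀ x : ℝ, 0 < x → ∀ t : ℝ,
      ‖(x : ℂ) ^ (-(1 + t * Complex.I) - 1)‖ = (x ^ 2)⁻¹ := fun x hx t => by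
    rw [Complex.norm_cpow_eq_rpow_re_of_pos hx, ← Real.rpow_natCast, ← Real.rpow_neg hx.le]
    simp
    norm_num
  have key := hasDerivAt_integral_of_dominated_loc_of_deriv_le (μ := volume)
    (F := fun (x : ℝ) (t : ℝ) => G t * (x : ℂ) ^ (-(1 + t * Complex.I)) / (1 + t * Complex.I))
    (F' := fun (x : ℝ) (t : ℝ) => -(G t * (x : ℂ) ^ (-(1 + t * Complex.I) - 1)))
    (x₀ := ξ) (s := Ioi (ξ / 2)) (bound := fun t => C * (1 + t ^ 2)⁻¹ * ((ξ / 2) ^ 2)⁻¹)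
    (Ioi_mem_nhds (by linarith))
    (by
      filter_upwards [Ioi_mem_nhds hξ] with x hx
      exact (hcont x hx).aestronglyMeasurable)
    (by
      refine ((integrable_inv_one_add_sq.const_mul C).mul_const ξ⁻¹).mono'
        (hcont ξ hξ).aestronglyMeasurable (Eventually.of_forall fun t => ?_)
      rw [norm_div, norm_mul, hnorm ξ hξ]
      refine (div_le_self (by positivity) (hs1 t)).trans ?_
      gcongr
      exact hC t)
    (by
      refine Continuous.aestronglyMeasurable (hGc.mul ?_).neg
      exact Continuous.const_cpow (by fun_prop) (Or.inl (by exact_mod_cast hξ.ne')))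
    (Eventually.of_forall fun t x hx => by
      have hx' : ξ / 2 < x := hx
      have hx0 : 0 < x := by linarith
      rw [norm_neg, norm_mul, hnorm' x hx0]
      refine mul_le_mul (hC t) ?_ (by positivity) ((norm_nonneg _).trans (hC t))
      gcongr)
    ((integrable_inv_one_add_sq.const_mul C).mul_const _)
    (Eventually.of_forall fun t x hx => by
      have hx' : ξ / 2 < x := hx
      have hx0 : 0 < x := by linarith
      have h := hasDerivAt_ofReal_cpow_const' (x := x) (r := -(1 + t * Complex.I) - 1)
        hx0.ne' ?_
      · have h2 := h.const_mul (-(G t))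
        refine (h2.congr_of_eventuallyEq ?_).congr_deriv (by ring)
        refine Eventually.of_forall fun y => ?_
        simp only [sub_add_cancel]
        field_simp [hs0 t]
      · intro h
        exact hs0 t (by linear_combination -h))
  refine (key.2.const_mul (1 / (2 * (π : ℂ)))).congr_deriv ?_
  simp only [mellinInv]
  rw [Complex.real_smul, mul_left_comm (-(ξ : ℂ)⁻¹), ← integral_const_mul (-(ξ : ℂ)⁻¹)]
  congr 1
  · push_cast; rfl
  · refine integral_congr_ae (Eventually.of_forall fun t => ?_)
    simp only [smul_eq_mul, Complex.ofReal_one, hG]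
    rw [Complex.cpow_sub _ _ (by exact_mod_cast hξ.ne'), Complex.cpow_one]
    ring

/-- If `k` has Mellin transform `c * Γ(s / 2 + 1 / 4) ^ j` at `s + 1 / 2`, then `ω_j'` is a
constant multiple of `ξ ^ (-1 / 2) * k ξ`. -/
theorem hasDerivAt_omegaJ (hj : 1 ≤ j) (hc : c ≠ 0) (hk : MellinConvergent k (3 / 2))
    (hkm : ∀ s : ℂ, s.re = 1 → mellin k (s + 1 / 2) = c * Complex.Gamma (s / 2 + 1 / 4) ^ j)
    (hcont : ContinuousOn k (Ioi 0)) {ξ : ℝ} (hξ : 0 < ξ) :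
    HasDerivAt (omegaJ j) (-(c * Complex.Gamma (1 / 4) ^ j)⁻¹ *
      (((ξ ^ (-1 / 2 : ℝ) : ℝ) : ℂ) * k ξ)) ξ := by
  refine (hasDerivAt_omegaJ_mellinInv hj hξ).congr_deriv ?_
  set K : ℂ := (c * Complex.Gamma (1 / 4) ^ j)⁻¹ with hK
  set f : ℝ → ℂ := fun t => K • ((t : ℂ) ^ (1 / 2 : ℂ) • k t) with hf
  have hM : ∀ t : ℝ, mellin f (((1 : ℝ) : ℂ) + t * Complex.I) =
      (Complex.Gamma ((((1 : ℝ) : ℂ) + t * Complex.I) / 2 + 1 / 4)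
        / Complex.Gamma (1 / 4)) ^ j := fun t => by
    rw [hf, mellin_const_smul, mellin_cpow_smul, hkm _ (by simp), hK, smul_eq_mul, div_pow]
    field_simp
  have hfc : MellinConvergent f ((1 : ℝ) : ℂ) := by
    refine MellinConvergent.const_smul (MellinConvergent.cpow_smul.2 ?_) _
    convert hk using 1
    push_cast; norm_num
  have hV : Complex.VerticalIntegrable (mellin f) 1 := by
    obtain ⟨C, hC⟩ := exists_norm_Gamma_ratio_pow_le hj
    simp only [Complex.VerticalIntegrable, hM]
    simp only [Complex.ofReal_one]
    exact (integrable_inv_one_add_sq.const_mul C).mono'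
      ((continuous_Gamma_three_quarters_add.div_const _).pow j).aestronglyMeasurable
      (Eventually.of_forall hC)
  have hfcont : ContinuousAt f ξ := by
    refine ContinuousAt.fun_const_smul (ContinuousAt.fun_smul ?_ (hcont.continuousAt (Ioi_mem_nhds hξ))) _
    exact Complex.continuousAt_ofReal_cpow_const _ _ (Or.inr hξ.ne')
  have hinv := mellinInv_mellin_eq 1 f hξ hfc hV hfcont
  have heq : mellinInv 1
      (fun s => (Complex.Gamma (s / 2 + 1 / 4) / Complex.Gamma (1 / 4)) ^ j) ξ = f ξ := by
    rw [← hinv, mellinInv, mellinInv]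
    simp only [hM]
  have hpow : (((ξ ^ (-1 / 2 : ℝ) : ℝ) : ℂ)) = (ξ : ℂ)⁻¹ * (ξ : ℂ) ^ (1 / 2 : ℂ) := by
    rw [show (-1 / 2 : ℝ) = -1 + 1 / 2 by norm_num, Real.rpow_add hξ, Real.rpow_neg_one]
    push_cast [Complex.ofReal_cpow hξ.le]
    rfl
  rw [heq, hf, hpow]
  simp only [smul_eq_mul]
  ring

end Derivative

section GaussianKernel

theorem mellin_exp_neg_rpow_two {w : ℂ} (hw : 0 < w.re) :
    mellin (fun x : ℝ => ((Real.exp (-x ^ (2 : ℝ)) : ℝ) : ℂ)) w =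
      1 / 2 * Complex.Gamma (w / 2) := by
  have h := mellin_comp_rpow (fun x : ℝ => ((Real.exp (-x) : ℝ) : ℂ)) w 2
  rw [h, ← Complex.GammaIntegral_eq_mellin, ← Complex.Gamma_eq_integral (by simpa using hw)]
  simp

theorem mellinConvergent_exp_neg_rpow_two {w : ℂ} (hw : 0 < w.re) :
    MellinConvergent (fun x : ℝ => ((Real.exp (-x ^ (2 : ℝ)) : ℝ) : ℂ)) w := by
  refine (MellinConvergent.comp_rpow (f := fun x : ℝ => ((Real.exp (-x) : ℝ) : ℂ))
    two_ne_zero).2 ?_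
  have h := Complex.GammaIntegral_convergent (s := w / 2) (by simpa using hw)
  refine h.congr_fun (fun x _ => ?_) measurableSet_Ioi
  simp [mul_comm]

theorem hasDerivAt_rpow_mul_exp_neg_sq (a : ℝ) {x : ℝ} (hx : 0 < x) :
    HasDerivAt (fun x : ℝ => ((x ^ a * Real.exp (-x ^ (2 : ℝ)) : ℝ) : ℂ))
      (a • ((x ^ (a - 1) * Real.exp (-x ^ (2 : ℝ)) : ℝ) : ℂ) +
        (-2 : ℝ) • ((x ^ (a + 1) * Real.exp (-x ^ (2 : ℝ)) : ℝ) : ℂ)) x := by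
  have h1 := Real.hasDerivAt_rpow_const (x := x) (p := a) (Or.inl hx.ne')
  have h2 := (Real.hasDerivAt_rpow_const (x := x) (p := 2) (Or.inl hx.ne')).neg.exp
  refine (h1.mul h2).ofReal_comp.congr_deriv ?_
  rw [Real.rpow_add_one hx.ne', show (2 : ℝ) - 1 = 1 by norm_num, Real.rpow_one]
  simp only [Complex.real_smul]
  simp only [Pi.neg_apply]
  push_cast
  ring

end GaussianKernel

section BesselKernel

/-- The weight `(x (1 - x)) ^ (-1 / 2)` on the unit interval. -/
noncomputable def betaWeight (x : ℝ) : ℝ := (√(x * (1 - x)))⁻¹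

/-- The Laplace transform of a power of the Beta weight; `besselKernel 2 ξ = 4 K₀(2ξ)`, and the
values `b ≥ 2` give, up to sign, its derivatives. -/
noncomputable def besselKernel (b : ℕ) (ξ : ℝ) : ℝ :=
  ∫ x in Ioo (0 : ℝ) 1, betaWeight x ^ b * Real.exp (-(betaWeight x * ξ))

theorem measurable_betaWeight : Measurable betaWeight := by
  unfold betaWeight
  fun_prop

theorem two_le_betaWeight {x : ℝ} (hx : x ∈ Ioo (0 : ℝ) 1) : 2 ≤ betaWeight x := by
  have hy : 0 < x * (1 - x) := mul_pos hx.1 (by linarith [hx.2])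
  rw [betaWeight, le_inv_comm₀ two_pos (Real.sqrt_pos.2 hy)]
  refine Real.sqrt_le_iff.2 ⟨by norm_num, ?_⟩
  nlinarith [sq_nonneg (x - 1 / 2)]

theorem betaWeight_sq_mul_cpow {x : ℝ} (hx : x ∈ Ioo (0 : ℝ) 1) (w : ℂ) :
    (betaWeight x : ℂ) ^ 2 * (1 / (betaWeight x : ℂ)) ^ w =
      (x : ℂ) ^ (w / 2 - 1) * (1 - (x : ℂ)) ^ (w / 2 - 1) := by
  have hx1 : 0 < 1 - x := by linarith [hx.2]
  have hy : 0 < x * (1 - x) := mul_pos hx.1 hx1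
  have hyc : ((x * (1 - x) : ℝ) : ℂ) ≠ 0 := by exact_mod_cast hy.ne'
  have h1 : (1 / (betaWeight x : ℂ)) ^ w = ((x * (1 - x) : ℝ) : ℂ) ^ (w / 2) := by
    have : (1 / (betaWeight x : ℂ)) = (((x * (1 - x)) ^ (1 / 2 : ℝ) : ℝ) : ℂ) := by
      rw [← Real.sqrt_eq_rpow, betaWeight]
      push_cast
      simp
    rw [this, ← Complex.cpow_mul_ofReal_nonneg hy.le]
    congr 1
    push_cast
    ring
  have h2 : (betaWeight x : ℂ) ^ 2 = (((x * (1 - x) : ℝ) : ℂ))⁻¹ := by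
    rw [← Complex.ofReal_pow, betaWeight, inv_pow, Real.sq_sqrt hy.le, Complex.ofReal_inv]
  have h3 : (1 - (x : ℂ)) = ((1 - x : ℝ) : ℂ) := by push_cast; rfl
  rw [h1, h2, h3, ← Complex.mul_cpow_ofReal_nonneg hx.1.le hx1.le, ← Complex.ofReal_mul,
    Complex.cpow_sub _ _ hyc, Complex.cpow_one]
  field_simp

theorem pow_mul_exp_neg_mul_le {q c : ℝ} (hq : 0 ≤ q) (hc : 0 < c) (n : ℕ) :
    q ^ n * Real.exp (-(q * c)) ≤ n.factorial / c ^ n := by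
  have h := Real.pow_div_factorial_le_exp (x := q * c) (by positivity) n
  rw [Real.exp_neg, ← div_eq_mul_inv, div_le_div_iff₀ (Real.exp_pos _) (by positivity),
    ← mul_pow, mul_comm (n.factorial : ℝ)]
  exact (div_le_iff₀ (by positivity)).1 h

theorem hasDerivAt_besselKernel (b : ℕ) {ξ : ℝ} (hξ : 0 < ξ) :
    HasDerivAt (besselKernel b) (-besselKernel (b + 1) ξ) ξ := by
  have hm : ∀ (n : ℕ) (y : ℝ), AEStronglyMeasurable
      (fun x => betaWeight x ^ n * Real.exp (-(betaWeight x * y)))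
      (volume.restrict (Ioo (0 : ℝ) 1)) := fun n y =>
    ((measurable_betaWeight.pow_const n).mul
      (measurable_betaWeight.mul_const y).neg.exp).aestronglyMeasurable
  have hbd : ∀ (n : ℕ) (y : ℝ), ξ / 2 < y → ∀ x ∈ Ioo (0 : ℝ) 1,
      ‖betaWeight x ^ n * Real.exp (-(betaWeight x * y))‖ ≤ n.factorial / (ξ / 2) ^ n :=
    fun n y hy x hx => by
      have hq : 0 ≤ betaWeight x := by linarith [two_le_betaWeight hx]
      rw [Real.norm_of_nonneg (by positivity)]
      refine le_trans ?_ (pow_mul_exp_neg_mul_le hq (half_pos hξ) n)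
      gcongr
  have key := hasDerivAt_integral_of_dominated_loc_of_deriv_le
    (μ := volume.restrict (Ioo (0 : ℝ) 1))
    (F := fun y x => betaWeight x ^ b * Real.exp (-(betaWeight x * y)))
    (F' := fun y x => -(betaWeight x ^ (b + 1) * Real.exp (-(betaWeight x * y))))
    (x₀ := ξ) (s := Ioi (ξ / 2))
    (bound := fun _ => (b + 1).factorial / (ξ / 2) ^ (b + 1))
    (Ioi_mem_nhds (by linarith))
    (Eventually.of_forall fun y => hm b y)
    (Integrable.of_bound (hm b ξ) (b.factorial / (ξ / 2) ^ b)
      (ae_restrict_of_forall_mem measurableSet_Ioo fun x hx => hbd b ξ (by linarith) x hx))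
    (hm (b + 1) ξ).neg
    (ae_restrict_of_forall_mem measurableSet_Ioo fun x hx y hy => by
      rw [norm_neg]
      exact hbd (b + 1) y hy x hx)
    (integrable_const _)
    (Eventually.of_forall fun x y _ => by
      have h := (((hasDerivAt_id y).const_mul (betaWeight x)).neg.exp).const_mul (betaWeight x ^ b)
      refine h.congr_deriv ?_
      simp only [Pi.neg_apply, id]
      ring)
  refine key.2.congr_deriv ?_
  rw [integral_neg, besselKernel]

theorem abs_besselKernel_le (b : ℕ) {ξ : ℝ} (hξ : 1 ≤ ξ) :
    |besselKernel b ξ| ≤ b.factorial * Real.exp 2 * Real.exp (-(2 * ξ)) := by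
  have h := norm_setIntegral_le_of_norm_le_const (μ := volume) (s := Ioo (0 : ℝ) 1)
    (f := fun x => betaWeight x ^ b * Real.exp (-(betaWeight x * ξ)))
    (C := b.factorial * Real.exp 2 * Real.exp (-(2 * ξ))) (by simp) fun x hx => by
      have h2 := two_le_betaWeight hx
      have hq : 0 ≤ betaWeight x := by linarith
      have h1 := pow_mul_exp_neg_mul_le hq one_pos b
      rw [Real.norm_of_nonneg (by positivity)]
      calc _ ≤ betaWeight x ^ b * Real.exp (-(betaWeight x * 1) + 2 + -(2 * ξ)) := by
            gcongr
            nlinarith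
        _ = betaWeight x ^ b * Real.exp (-(betaWeight x * 1)) * Real.exp 2 *
            Real.exp (-(2 * ξ)) := by
            rw [Real.exp_add, Real.exp_add]; ring
        _ ≤ _ := by
            gcongr
            simpa using h1
  simpa [besselKernel] using h

theorem integrable_cpow_mul_betaWeight {w : ℂ} (hw : 0 < w.re) :
    Integrable (fun p : ℝ × ℝ => (p.1 : ℂ) ^ (w - 1) *
      ((betaWeight p.2 ^ 2 * Real.exp (-(betaWeight p.2 * p.1)) : ℝ) : ℂ))
      ((volume.restrict (Ioi 0)).prod (volume.restrict (Ioo 0 1))) := by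
  have hmeas : Measurable fun p : ℝ × ℝ => (p.1 : ℂ) ^ (w - 1) *
      ((betaWeight p.2 ^ 2 * Real.exp (-(betaWeight p.2 * p.1)) : ℝ) : ℂ) := by
    have := measurable_betaWeight
    fun_prop
  have hnorm : ∀ x : ℝ, ∀ t ∈ Ioi (0 : ℝ), ‖(t : ℂ) ^ (w - 1) *
      ((betaWeight x ^ 2 * Real.exp (-(betaWeight x * t)) : ℝ) : ℂ)‖ =
      betaWeight x ^ 2 * (t ^ (w.re - 1) * Real.exp (-(betaWeight x * t))) := fun x t ht => by
    rw [norm_mul, Complex.norm_cpow_eq_rpow_re_of_pos ht, Complex.norm_real,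
      Real.norm_of_nonneg (by positivity), Complex.sub_re, Complex.one_re]
    ring
  refine (integrable_prod_iff' hmeas.aestronglyMeasurable).2 ⟨?_, ?_⟩
  · refine ae_restrict_of_forall_mem measurableSet_Ioo fun x hx => ?_
    have hq : 0 < betaWeight x := by linarith [two_le_betaWeight hx]
    have hint : Integrable (fun t : ℝ => t ^ (w.re - 1) * Real.exp (-(betaWeight x * t)))
        (volume.restrict (Ioi 0)) := by
      refine .of_integral_ne_zero ?_
      rw [Real.integral_rpow_mul_exp_neg_mul_Ioi hw hq]
      have := Real.Gamma_pos_of_pos hw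
      positivity
    refine (hint.const_mul (betaWeight x ^ 2)).mono'
      (hmeas.comp (measurable_id.prodMk measurable_const)).aestronglyMeasurable ?_
    exact ae_restrict_of_forall_mem measurableSet_Ioi fun t ht => (hnorm x t ht).le
  · have hw2 : 0 < (w / 2).re := by simpa using hw
    have hbeta := (intervalIntegrable_iff_integrableOn_Ioo_of_le zero_le_one).1
      (Complex.betaIntegral_convergent hw2 hw2)
    refine IntegrableOn.congr_fun (hbeta.norm.mul_const (Real.Gamma w.re)) (fun x hx => ?_)
      measurableSet_Ioo
    have hq : 0 < betaWeight x := by linarith [two_le_betaWeight hx]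
    simp only
    rw [setIntegral_congr_fun measurableSet_Ioi (hnorm x), integral_const_mul,
      Real.integral_rpow_mul_exp_neg_mul_Ioi hw hq, ← betaWeight_sq_mul_cpow hx, norm_mul,
      norm_pow, Complex.norm_real, Real.norm_of_nonneg hq.le,
      show (1 / (betaWeight x : ℂ)) = ((1 / betaWeight x : ℝ) : ℂ) by push_cast; rfl,
      Complex.norm_cpow_eq_rpow_re_of_pos (by positivity), mul_assoc]

theorem cpow_smul_besselKernel_two (w : ℂ) (t : ℝ) :
    (t : ℂ) ^ (w - 1) • ((besselKernel 2 t : ℝ) : ℂ) = ∫ x in Ioo (0 : ℝ) 1, (t : ℂ) ^ (w - 1) *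
      ((betaWeight x ^ 2 * Real.exp (-(betaWeight x * t)) : ℝ) : ℂ) := by
  rw [integral_const_mul, integral_complex_ofReal, smul_eq_mul, besselKernel]

theorem mellinConvergent_besselKernel_two {w : ℂ} (hw : 0 < w.re) :
    MellinConvergent (fun t => ((besselKernel 2 t : ℝ) : ℂ)) w := by
  simp only [MellinConvergent, cpow_smul_besselKernel_two]
  exact (integrable_cpow_mul_betaWeight hw).integral_prod_left

theorem mellin_besselKernel_two {w : ℂ} (hw : 0 < w.re) :
    mellin (fun t => ((besselKernel 2 t : ℝ) : ℂ)) w = Complex.Gamma (w / 2) ^ 2 := by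
  have hw2 : 0 < (w / 2).re := by simpa using hw
  simp only [mellin, cpow_smul_besselKernel_two]
  rw [integral_integral_swap (integrable_cpow_mul_betaWeight hw), sq,
    Complex.Gamma_mul_Gamma_eq_betaIntegral hw2 hw2, add_halves, Complex.betaIntegral,
    intervalIntegral.integral_of_le zero_le_one, integral_Ioc_eq_integral_Ioo,
    ← integral_const_mul]
  refine setIntegral_congr_fun measurableSet_Ioo fun x hx => ?_
  have hq : 0 < betaWeight x := by linarith [two_le_betaWeight hx]
  rw [← betaWeight_sq_mul_cpow hx, mul_left_comm, mul_comm (Complex.Gamma w),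
    ← Complex.integral_cpow_mul_exp_neg_mul_Ioi hw hq, ← integral_const_mul]
  refine integral_congr_ae (Eventually.of_forall fun t => ?_)
  push_cast
  ring

theorem hasDerivAt_rpow_mul_besselKernel (a : ℝ) (b : ℕ) {x : ℝ} (hx : 0 < x) :
    HasDerivAt (fun x : ℝ => ((x ^ a * besselKernel b x : ℝ) : ℂ))
      (a • ((x ^ (a - 1) * besselKernel b x : ℝ) : ℂ) +
        (-1 : ℝ) • ((x ^ a * besselKernel (b + 1) x : ℝ) : ℂ)) x := by
  have h1 := Real.hasDerivAt_rpow_const (x := x) (p := a) (Or.inl hx.ne')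
  refine (h1.mul (hasDerivAt_besselKernel b hx)).ofReal_comp.congr_deriv ?_
  simp only [Complex.real_smul]
  push_cast
  ring

end BesselKernel

section Assembly

theorem exists_pow_mul_exp_neg_le {j : ℕ} (hj : j = 1 ∨ j = 2) (n : ℕ) :
    ∃ C : ℝ, ∀ ξ : ℝ, 1 ≤ ξ → ξ ^ n * Real.exp (-(j : ℝ) * ξ ^ ((2 : ℝ) / j)) ≤
      C * Real.exp (-((j : ℝ) / 2) * ξ ^ ((2 : ℝ) / j)) := by
  refine ⟨n.factorial / (1 / 2) ^ n, fun ξ hξ => ?_⟩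
  have hj1 : (1 : ℝ) ≤ j := by rcases hj with rfl | rfl <;> norm_num
  have hj2 : (1 : ℝ) ≤ 2 / j := by rcases hj with rfl | rfl <;> norm_num
  set y := ξ ^ ((2 : ℝ) / j)
  have hy : ξ ≤ y := Real.self_le_rpow_of_one_le hξ hj2
  have hξ0 : 0 < ξ := by linarith
  calc _ ≤ y ^ n * Real.exp (-(y * (1 / 2)) + -((j : ℝ) / 2) * y) := by
        gcongr
        nlinarith
    _ = y ^ n * Real.exp (-(y * (1 / 2))) * Real.exp (-((j : ℝ) / 2) * y) := by
        rw [Real.exp_add, mul_assoc]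
    _ ≤ _ := by
        gcongr
        exact pow_mul_exp_neg_mul_le (by linarith) (by norm_num) n

/-- Smoothness and decay of `ω_j`, given that `ω_j'` is a multiple of a member of a family of
functions stable under differentiation with the appropriate decay. -/
theorem omegaJ_bounds_of_deriv_stable {ι : Type*} {f : ι → ℝ → ℂ} {a b : ι → ℝ} {u v : ι → ι}
    {d : ι → ℝ} {i : ι} {K : ℂ} {j : ℕ} (hj : j = 1 ∨ j = 2)
    (hd : ∀ i, ∀ x, 0 < x → HasDerivAt (f i) (a i • f (u i) x + b i • f (v i) x) x)
    (hu : ∀ i, d (u i) ≤ d i + 1) (hv : ∀ i, d (v i) ≤ d i + 1)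
    (hf : ∀ i, ∃ C, 0 ≤ C ∧ ∀ x, 1 ≤ x →
      ‖f i x‖ ≤ C * x ^ d i * Real.exp (-(j : ℝ) * x ^ ((2 : ℝ) / j)))
    (hi : d i ≤ 0) (hω : ∀ ξ, 0 < ξ → HasDerivAt (omegaJ j) (K * f i ξ) ξ) :
    ContDiffOn ℝ (⊤ : ℕ∞) (omegaJ j) (Set.Ioi 0) ∧
    ∀ ν : ℕ, 1 ≤ ν →
      (∃ C : ℝ, ∀ ξ : ℝ, 1 ≤ ξ →
        ‖iteratedDeriv ν (omegaJ j) ξ‖ ≤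
          C * ξ ^ (2 * ν + 2) * Real.exp (-(j : ℝ) * ξ ^ ((2 : ℝ) / j))) ∧
      (∃ C' : ℝ, ∀ ξ : ℝ, 1 ≤ ξ →
        ‖iteratedDeriv ν (omegaJ j) ξ‖ ≤
          C' * Real.exp (-((j : ℝ) / 2) * ξ ^ ((2 : ℝ) / j))) := by
  refine ⟨(contDiffOn_infty_iff_deriv_of_isOpen isOpen_Ioi).2
    ⟨fun x hx => (hω x hx).differentiableAt.differentiableWithinAt, ?_⟩, fun ν hν => ?_⟩
  · exact (contDiffOn_const.mul (contDiffOn_of_deriv_stable hd i)).congr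
      fun x hx => (hω x hx).deriv
  obtain ⟨n, rfl⟩ : ∃ n, ν = n + 1 := ⟨ν - 1, by omega⟩
  obtain ⟨C, hC, hCb⟩ := exists_norm_iteratedDeriv_le_of_deriv_stable hd
    (fun x => (Real.exp_pos (-(j : ℝ) * x ^ ((2 : ℝ) / j))).le) hu hv hf n i
  have hbound : ∀ ξ : ℝ, 1 ≤ ξ → ‖iteratedDeriv (n + 1) (omegaJ j) ξ‖ ≤
      ‖K‖ * C * ξ ^ (2 * (n + 1) + 2) * Real.exp (-(j : ℝ) * ξ ^ ((2 : ℝ) / j)) := fun ξ hξ => by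
    have hξ0 : 0 < ξ := by linarith
    have heq : deriv (omegaJ j) =ᶠ[𝓝 ξ] fun x => K * f i x := by
      filter_upwards [Ioi_mem_nhds hξ0] with y hy
      exact (hω y hy).deriv
    have hpow : ξ ^ (d i + n) ≤ ξ ^ (2 * (n + 1) + 2) := by
      rw [← Real.rpow_natCast]
      refine Real.rpow_le_rpow_of_exponent_le hξ ?_
      push_cast
      linarith [(n.cast_nonneg : (0 : ℝ) ≤ n)]
    rw [iteratedDeriv_succ', heq.iteratedDeriv_eq, iteratedDeriv_const_mul_field, norm_mul,
      mul_assoc, mul_assoc]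
    gcongr
    refine (hCb ξ hξ).trans ?_
    rw [mul_assoc]
    exact mul_le_mul_of_nonneg_left
      (mul_le_mul_of_nonneg_right hpow (Real.exp_pos _).le) hC
  obtain ⟨D, hD⟩ := exists_pow_mul_exp_neg_le hj (2 * (n + 1) + 2)
  refine ⟨⟨‖K‖ * C, hbound⟩, ‖K‖ * C * D, fun ξ hξ => (hbound ξ hξ).trans ?_⟩
  rw [mul_assoc, mul_assoc (‖K‖ * C)]
  exact mul_le_mul_of_nonneg_left (hD ξ hξ) (by positivity)

end Assembly

/-- For `j ∈ {1,2}`, `ω_j` is smooth on `(0,∞)`, and for every positive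
integer `ν` there is a constant `C = C(ν,j)` with
`|ω_j^{(ν)}(ξ)| ≤ C·ξ^{2ν+2}·exp(−j·ξ^{2/j})` for all `ξ ≥ 1`; in particular there is a
constant `C' = C'(ν,j)` with `|ω_j^{(ν)}(ξ)| ≤ C'·exp(−(j/2)·ξ^{2/j})` for all `ξ ≥ 1`. -/
theorem stmt_10 (j : ℕ) (hj : j = 1 ∨ j = 2) :
    ContDiffOn ℝ (⊤ : ℕ∞) (omegaJ j) (Set.Ioi 0) ∧
    ∀ ν : ℕ, 1 ≤ ν →
      (∃ C : ℝ, ∀ ξ : ℝ, 1 ≤ ξ →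
        ‖iteratedDeriv ν (omegaJ j) ξ‖ ≤
          C * ξ ^ (2 * ν + 2) * Real.exp (-(j : ℝ) * ξ ^ ((2 : ℝ) / j))) ∧
      (∃ C' : ℝ, ∀ ξ : ℝ, 1 ≤ ξ →
        ‖iteratedDeriv ν (omegaJ j) ξ‖ ≤
          C' * Real.exp (-((j : ℝ) / 2) * ξ ^ ((2 : ℝ) / j))) := by
  have hre : ∀ s : ℂ, s.re = 1 → 0 < (s + 1 / 2).re := fun s hs => by
    simp [hs]
    norm_num
  have hhalf : ∀ s : ℂ, (s + 1 / 2) / 2 = s / 2 + 1 / 4 := fun s => by ring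
  rcases hj with rfl | rfl
  · refine omegaJ_bounds_of_deriv_stable (ι := ℝ) (d := id) (i := -1 / 2)
      (K := -((1 / 2) * Complex.Gamma (1 / 4) ^ 1)⁻¹)
      (f := fun a x => ((x ^ a * Real.exp (-x ^ (2 : ℝ)) : ℝ) : ℂ)) (Or.inl rfl)
      (fun a x hx => hasDerivAt_rpow_mul_exp_neg_sq a hx) (fun a => by simp; linarith)
      (fun a => le_rfl) (fun a => ⟨1, zero_le_one, fun x hx => ?_⟩) (by norm_num) fun ξ hξ => ?_
    · have hx0 : 0 < x := by linarith
      rw [Complex.norm_real, Real.norm_of_nonneg (by positivity)]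
      simp
    · have h := hasDerivAt_omegaJ (j := 1) (c := 1 / 2) le_rfl (by norm_num)
        (mellinConvergent_exp_neg_rpow_two (by norm_num))
        (fun s hs => by rw [mellin_exp_neg_rpow_two (hre s hs), hhalf, pow_one])
        (by
          refine Continuous.continuousOn (Complex.continuous_ofReal.comp ?_)
          exact Real.continuous_exp.comp (Real.continuous_rpow_const two_pos.le).neg) hξ
      exact h.congr_deriv (by push_cast; rfl)
  · refine omegaJ_bounds_of_deriv_stable (ι := ℝ × ℕ) (d := Prod.fst) (i := (-1 / 2, 2))
      (K := -(1 * Complex.Gamma (1 / 4) ^ 2)⁻¹)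
      (f := fun p x => ((x ^ p.1 * besselKernel p.2 x : ℝ) : ℂ)) (Or.inr rfl)
      (u := fun p => (p.1 - 1, p.2)) (v := fun p => (p.1, p.2 + 1))
      (fun p x hx => hasDerivAt_rpow_mul_besselKernel p.1 p.2 hx)
      (fun p => by simp; linarith) (fun p => by simp)
      (fun p => ⟨p.2.factorial * Real.exp 2, by positivity, fun x hx => ?_⟩)
      (by norm_num) fun ξ hξ => ?_
    · have hx0 : 0 < x := by linarith
      have h := abs_besselKernel_le p.2 hx
      rw [Complex.norm_real, norm_mul, Real.norm_of_nonneg (Real.rpow_nonneg hx0.le _),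
        Real.norm_eq_abs]
      calc _ ≤ x ^ p.1 * (p.2.factorial * Real.exp 2 * Real.exp (-(2 * x))) := by gcongr
        _ = _ := by
          norm_num
          ring
    · have h := hasDerivAt_omegaJ (j := 2) (c := 1) (by norm_num) one_ne_zero
        (mellinConvergent_besselKernel_two (by norm_num))
        (fun s hs => by rw [mellin_besselKernel_two (hre s hs), hhalf, one_mul])
        (fun x hx => (hasDerivAt_besselKernel 2 hx).ofReal_comp.continuousAt.continuousWithinAt)
        hξ
      exact h.congr_deriv (by push_cast; rfl)
end

section
/- Let χ be an even primitive Dirichlet character of modulus N > 1. Then L(1/2, χ) = Σ_{n=1}^{∞} n^{−1/2} · ( χ(n) + (τ(χ)/N^{1/2}) · χ̄(n) ) · ω₁( n·√(π/N) ), the series converging absolutely. -/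
open scoped Real

/-- The Gauss sum `τ(χ) = Σ_{a mod N} χ(a) e(a/N)`. -/
noncomputable def gaussTau {N : ℕ} (χ : DirichletCharacter ℂ N) : ℂ :=
  ∑ a ∈ Finset.range N, χ (a : ZMod N) * eC ((a : ℝ) / N)

open Complex MeasureTheory Set Filter Topology

/-- The exponential integral `∫₁^∞ t ^ (-3/4) e ^ (-tv) dt`, equal to `v ^ (-1/4) Γ(1/4, v)`. -/
noncomputable def expTailIntegral (v : ℝ) : ℂ :=
  ∫ t in Ioi (1 : ℝ), (t : ℂ) ^ (-(3 / 4) : ℂ) * cexp (-(t * v))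

lemma norm_expTail_integrand {t : ℝ} (ht : 1 < t) (v : ℝ) :
    ‖(t : ℂ) ^ (-(3 / 4) : ℂ) * cexp (-(t * v))‖ ≤ Real.exp (-v * t) := by
  rw [norm_mul, norm_cpow_eq_rpow_re_of_pos (by linarith), norm_exp]
  have h1 : t ^ ((-(3 / 4) : ℂ)).re ≤ 1 := Real.rpow_le_one_of_one_le_of_nonpos ht.le (by norm_num)
  have h2 : (-((t : ℂ) * v)).re = -v * t := by simp [mul_comm]
  rw [h2]
  exact mul_le_of_le_one_left (Real.exp_pos _).le h1

lemma continuousOn_expTail_integrand (v : ℝ) :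
    ContinuousOn (fun t : ℝ ↦ (t : ℂ) ^ (-(3 / 4) : ℂ) * cexp (-(t * v))) (Ioi 1) := by
  refine ContinuousOn.mul (fun t ht ↦ ContinuousAt.continuousWithinAt ?_) (by fun_prop)
  exact continuousAt_ofReal_cpow_const _ _ (Or.inr (by linarith [mem_Ioi.1 ht]))

lemma integrableOn_expTail_integrand {v : ℝ} (hv : 0 < v) :
    IntegrableOn (fun t : ℝ ↦ (t : ℂ) ^ (-(3 / 4) : ℂ) * cexp (-(t * v))) (Ioi 1) := by
  refine Integrable.mono' (exp_neg_integrableOn_Ioi 1 hv)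
    ((continuousOn_expTail_integrand v).aestronglyMeasurable measurableSet_Ioi) ?_
  filter_upwards [ae_restrict_mem measurableSet_Ioi] with t ht
  exact norm_expTail_integrand ht v

lemma integral_norm_expTail_integrand_le {v : ℝ} (hv : 0 < v) :
    ∫ t in Ioi (1 : ℝ), ‖(t : ℂ) ^ (-(3 / 4) : ℂ) * cexp (-(t * v))‖ ≤ 1 / v := by
  calc _ ≤ ∫ t in Ioi (1 : ℝ), Real.exp (-v * t) :=
        setIntegral_mono_on (integrableOn_expTail_integrand hv).norm
          (exp_neg_integrableOn_Ioi 1 hv) measurableSet_Ioi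
          fun t ht ↦ norm_expTail_integrand ht v
    _ = Real.exp (-v) / v := by
        rw [integral_exp_mul_Ioi (by linarith)]; simp
    _ ≤ 1 / v := by gcongr; simpa using hv.le

lemma continuousAt_expTailIntegral {v : ℝ} (hv : 0 < v) : ContinuousAt expTailIntegral v := by
  refine continuousAt_of_dominated (bound := fun t ↦ Real.exp (-(v / 2) * t)) ?_ ?_
    (exp_neg_integrableOn_Ioi 1 (half_pos hv)) ?_
  · exact Eventually.of_forall fun w ↦
      (continuousOn_expTail_integrand w).aestronglyMeasurable measurableSet_Ioi
  · filter_upwards [lt_mem_nhds (half_lt_self hv)] with w hw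
    filter_upwards [ae_restrict_mem measurableSet_Ioi] with t ht
    refine (norm_expTail_integrand ht w).trans (Real.exp_le_exp.2 ?_)
    nlinarith [mem_Ioi.1 ht]
  · exact Eventually.of_forall fun t ↦ by fun_prop

lemma integrable_expTail_prod {z : ℂ} (hz : 1 / 4 < z.re) :
    Integrable (fun p : ℝ × ℝ ↦ (p.1 : ℂ) ^ (z - 1) *
      ((p.2 : ℂ) ^ (-(3 / 4) : ℂ) * cexp (-(p.2 * p.1))))
      ((volume.restrict (Ioi 0)).prod (volume.restrict (Ioi 1))) := by
  have hz0 : 0 < z.re := by linarith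
  have hmeas : AEStronglyMeasurable (fun p : ℝ × ℝ ↦ (p.1 : ℂ) ^ (z - 1) *
      ((p.2 : ℂ) ^ (-(3 / 4) : ℂ) * cexp (-(p.2 * p.1))))
      ((volume.restrict (Ioi 0)).prod (volume.restrict (Ioi 1))) := by
    apply Measurable.aestronglyMeasurable
    fun_prop
  have hnorm : ∀ v ∈ Ioi (0 : ℝ), ∀ t ∈ Ioi (1 : ℝ), ‖(v : ℂ) ^ (z - 1) *
      ((t : ℂ) ^ (-(3 / 4) : ℂ) * cexp (-(t * v)))‖ =
      t ^ (-(3 / 4) : ℝ) * (v ^ (z.re - 1) * Real.exp (-(t * v))) := by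
    intro v hv t ht
    have ht' : 0 < t := by linarith [mem_Ioi.1 ht]
    rw [norm_mul, norm_mul, norm_cpow_eq_rpow_re_of_pos hv, norm_cpow_eq_rpow_re_of_pos ht',
      norm_exp]
    have h2 : (-((t : ℂ) * v)).re = -(t * v) := by simp
    have h3 : ((-(3 / 4) : ℂ)).re = (-(3 / 4) : ℝ) := by norm_num
    rw [h2, h3]
    simp only [sub_re, one_re]
    ring
  have hint : ∀ t ∈ Ioi (1 : ℝ), IntegrableOn
      (fun v : ℝ ↦ v ^ (z.re - 1) * Real.exp (-(t * v))) (Ioi 0) := by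
    intro t ht
    have ht' : 0 < t := by linarith [mem_Ioi.1 ht]
    have := integrableOn_rpow_mul_exp_neg_mul_rpow (p := 1) (s := z.re - 1) (by linarith)
      one_pos ht'
    simpa using this
  rw [integrable_prod_iff' hmeas]
  constructor
  · filter_upwards [ae_restrict_mem measurableSet_Ioi] with t ht
    refine Integrable.mono' ((hint t ht).const_mul (t ^ (-(3 / 4) : ℝ)))
      (Measurable.aestronglyMeasurable (by fun_prop)) ?_
    filter_upwards [ae_restrict_mem measurableSet_Ioi] with v hv
    exact (hnorm v hv t ht).le
  · have key : IntegrableOn (fun t : ℝ ↦ t ^ (-(3 / 4) - z.re) * Real.Gamma z.re) (Ioi 1) :=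
      (integrableOn_Ioi_rpow_of_lt (by linarith) one_pos).mul_const _
    refine key.congr_fun (fun t ht ↦ ?_) measurableSet_Ioi
    have ht' : 0 < t := by linarith [mem_Ioi.1 ht]
    simp only
    rw [setIntegral_congr_fun measurableSet_Ioi fun v hv ↦ hnorm v hv t ht, integral_const_mul,
      Real.integral_rpow_mul_exp_neg_mul_Ioi hz0 ht', Real.rpow_sub ht', one_div,
      Real.inv_rpow ht'.le]
    ring

lemma hasMellin_expTailIntegral {z : ℂ} (hz : 1 / 4 < z.re) :
    HasMellin expTailIntegral z (Gamma z / (z - 1 / 4)) := by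
  have hz0 : 0 < z.re := by linarith
  have hint := integrable_expTail_prod hz
  have hconst (v : ℝ) : ∫ t in Ioi (1 : ℝ), (v : ℂ) ^ (z - 1) *
      ((t : ℂ) ^ (-(3 / 4) : ℂ) * cexp (-(t * v))) = (v : ℂ) ^ (z - 1) • expTailIntegral v := by
    rw [integral_const_mul, expTailIntegral, smul_eq_mul]
  constructor
  · have := hint.integral_prod_left
    simpa only [hconst, MellinConvergent, IntegrableOn] using this
  · have := integral_integral_swap (f := fun v t : ℝ ↦ (v : ℂ) ^ (z - 1) *
      ((t : ℂ) ^ (-(3 / 4) : ℂ) * cexp (-(t * v)))) hint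
    simp only [hconst] at this
    rw [mellin, this]
    have hinner : ∀ t ∈ Ioi (1 : ℝ), ∫ v in Ioi (0 : ℝ), (v : ℂ) ^ (z - 1) *
        ((t : ℂ) ^ (-(3 / 4) : ℂ) * cexp (-(t * v))) = (t : ℂ) ^ (-(3 / 4) - z) * Gamma z := by
      intro t ht
      have ht' : 0 < t := by linarith [mem_Ioi.1 ht]
      have hne : (t : ℂ) ≠ 0 := ofReal_ne_zero.2 ht'.ne'
      calc _ = ∫ v in Ioi (0 : ℝ), (t : ℂ) ^ (-(3 / 4) : ℂ) *
            ((v : ℂ) ^ (z - 1) * cexp (-(t * v))) := by congr 1; ext v; ring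
        _ = _ := by
          rw [integral_const_mul, integral_cpow_mul_exp_neg_mul_Ioi hz0 ht', cpow_sub _ _ hne,
            one_div, inv_cpow _ _ (by rw [arg_ofReal_of_nonneg ht'.le]; exact Real.pi_pos.ne)]
          ring
    rw [setIntegral_congr_fun measurableSet_Ioi hinner, integral_mul_const,
      integral_Ioi_cpow_of_lt (by norm_num; linarith) one_pos]
    have h1 : z - 1 / 4 ≠ 0 := by
      intro h
      have := congrArg re h
      norm_num at this
      linarith
    rw [show -(3 / 4) - z + 1 = -(z - 1 / 4) by ring, ofReal_one, one_cpow]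
    field_simp

lemma hasMellin_sqrt_mul_expTailIntegral_sq {s : ℂ} (hs : 0 < s.re) :
    HasMellin (fun x : ℝ ↦ (x : ℂ) ^ (1 / 2 : ℂ) • expTailIntegral (x ^ (2 : ℝ))) s
      (Gamma (s / 2 + 1 / 4) / s) := by
  have hre : ((s + 1 / 2) / ((2 : ℝ) : ℂ)).re = s.re / 2 + 1 / 4 := by
    rw [div_ofReal_re]; norm_num; ring
  have h := hasMellin_expTailIntegral (z := (s + 1 / 2) / ((2 : ℝ) : ℂ)) (by rw [hre]; linarith)
  constructor
  · rw [MellinConvergent.cpow_smul, MellinConvergent.comp_rpow two_ne_zero]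
    exact h.1
  · rw [mellin_cpow_smul, mellin_comp_rpow, h.2]
    have hs0 : s ≠ 0 := by rintro rfl; simp at hs
    have e1 : (s + 1 / 2) / ((2 : ℝ) : ℂ) = s / 2 + 1 / 4 := by push_cast; ring
    rw [e1]
    simp
    field_simp

lemma norm_Gamma_le {z : ℂ} (hz : 0 < z.re) : ‖Gamma z‖ ≤ Real.Gamma z.re := by
  rw [Complex.Gamma_eq_integral hz, Real.Gamma_eq_integral hz, Complex.GammaIntegral]
  refine (norm_integral_le_integral_norm _).trans (le_of_eq ?_)
  refine setIntegral_congr_fun measurableSet_Ioi fun x hx ↦ ?_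
  simp only [norm_mul, norm_cpow_eq_rpow_re_of_pos hx, sub_re, one_re]
  rw [norm_real, Real.norm_of_nonneg (Real.exp_pos _).le]

lemma integrable_Gamma_div_vertical :
    Integrable (fun t : ℝ ↦ Gamma ((1 + t * I) / 2 + 1 / 4) / (1 + t * I)) := by
  have hre (t : ℝ) : ((1 + t * I) / 2 + 1 / 4).re = 3 / 4 := by
    have : (1 + t * I) / 2 + 1 / 4 = ((3 / 4 : ℝ) : ℂ) + (t / 2 : ℝ) * I := by push_cast; ring
    rw [this]; simp
  have hne (t : ℝ) : (1 + t * I) ≠ 0 := fun h ↦ by simpa using congrArg re h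
  refine Integrable.mono' (integrable_inv_one_add_sq.const_mul (2 * Real.Gamma (7 / 4)))
    (Continuous.aestronglyMeasurable ?_) (Eventually.of_forall fun t ↦ ?_)
  · refine Continuous.div (continuous_iff_continuousAt.2 fun t ↦ ?_) (by fun_prop) hne
    refine ContinuousAt.comp (f := fun t : ℝ ↦ (1 + t * I) / 2 + 1 / 4)
      (differentiableAt_Gamma _ fun m h ↦ ?_).continuousAt (by fun_prop)
    have := congrArg re h
    rw [hre] at this
    have h' : (0 : ℝ) ≤ m := m.cast_nonneg
    simp at this
    linarith
  · set z := (1 + t * I) / 2 + 1 / 4 with hz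
    have hz0 : z ≠ 0 := fun h ↦ by
      have := hre t
      rw [← hz, h, zero_re] at this
      norm_num at this
    have hG : ‖Gamma z‖ * ‖z‖ ≤ Real.Gamma (7 / 4) := by
      rw [mul_comm, ← norm_mul, ← Gamma_add_one z hz0]
      have := norm_Gamma_le (z := z + 1) (by rw [add_re, hre]; norm_num)
      rw [add_re, hre] at this
      norm_num at this
      exact this
    have hn1 : ‖1 + t * I‖ ^ 2 = 1 + t ^ 2 := by
      rw [← normSq_eq_norm_sq, normSq_apply]; simp; ring
    have hn2 : ‖1 + t * I‖ ≤ 2 * ‖z‖ := by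
      have hzn : ‖z‖ ^ 2 = 9 / 16 + t ^ 2 / 4 := by
        have : z = ((3 / 4 : ℝ) : ℂ) + (t / 2 : ℝ) * I := by rw [hz]; push_cast; ring
        rw [← normSq_eq_norm_sq, this, normSq_add_mul_I]; ring
      refine le_of_sq_le_sq ?_ (by positivity)
      rw [hn1, mul_pow, hzn]; nlinarith
    have hp : 0 < ‖1 + t * I‖ := norm_pos_iff.2 (hne t)
    rw [norm_div, ← hn1, div_le_iff₀ hp]
    have : 2 * Real.Gamma (7 / 4) * (‖1 + t * I‖ ^ 2)⁻¹ * ‖1 + t * I‖ =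
        2 * Real.Gamma (7 / 4) / ‖1 + t * I‖ := by field_simp
    rw [this, le_div_iff₀ hp]
    nlinarith [norm_nonneg (Gamma z)]

/-- `ω₁` as a normalised incomplete Gamma function. -/
lemma omegaJ_one_eq {x : ℝ} (hx : 0 < x) :
    omegaJ 1 x = (x : ℂ) ^ (1 / 2 : ℂ) * expTailIntegral (x ^ 2) / Gamma (1 / 4) := by
  have hline (t : ℝ) : mellin (fun x : ℝ ↦ (x : ℂ) ^ (1 / 2 : ℂ) •
      expTailIntegral (x ^ (2 : ℝ))) (((1 : ℝ) : ℂ) + t * I) =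
      Gamma ((1 + t * I) / 2 + 1 / 4) / (1 + t * I) := by
    rw [(hasMellin_sqrt_mul_expTailIntegral_sq (by simp)).2, ofReal_one]
  have hinv := mellinInv_mellin_eq 1 (fun x : ℝ ↦ (x : ℂ) ^ (1 / 2 : ℂ) •
      expTailIntegral (x ^ (2 : ℝ))) hx
    (hasMellin_sqrt_mul_expTailIntegral_sq (s := ((1 : ℝ) : ℂ)) (by simp)).1
    (by simpa only [VerticalIntegrable, hline] using integrable_Gamma_div_vertical)
    (by
      refine ContinuousAt.smul (continuousAt_ofReal_cpow_const _ _ (Or.inr hx.ne')) ?_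
      refine ContinuousAt.comp (f := fun x : ℝ ↦ x ^ (2 : ℝ))
        (continuousAt_expTailIntegral (by positivity)) ?_
      exact Real.continuousAt_rpow_const _ _ (Or.inl hx.ne'))
  simp only [mellinInv, hline] at hinv
  simp only [smul_eq_mul, Real.rpow_two, ofReal_one] at hinv
  rw [← hinv, omegaJ, real_smul, mul_div_assoc, ← integral_div]
  push_cast
  congr 2
  ext t
  rw [pow_one]
  ring

lemma hasSum_mul_expTailIntegral {N : ℕ} (hN : 0 < N) {c : ℕ → ℂ} {C : ℝ} (hc : ∀ n, ‖c n‖ ≤ C)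
    (h0 : c 0 = 0) {h : ℝ → ℂ}
    (hh : ∀ t : ℝ, 1 < t → HasSum (fun n : ℕ ↦ c n * cexp (-(t * (π * n ^ 2 / N : ℝ)))) (h t)) :
    (Summable fun n : ℕ ↦ ‖c n * expTailIntegral (π * n ^ 2 / N)‖) ∧
    HasSum (fun n : ℕ ↦ c n * expTailIntegral (π * n ^ 2 / N))
      (∫ t in Ioi (1 : ℝ), (t : ℂ) ^ (-(3 / 4) : ℂ) * h t) := by
  have hN' : (0 : ℝ) < N := Nat.cast_pos.2 hN
  have hC : 0 ≤ C := (norm_nonneg _).trans (hc 0)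
  let F (n : ℕ) (t : ℝ) : ℂ := c n * ((t : ℂ) ^ (-(3 / 4) : ℂ) * cexp (-(t * (π * n ^ 2 / N : ℝ))))
  have hpos {n : ℕ} (hn : n ≠ 0) : 0 < π * n ^ 2 / N := by
    have : (0 : ℝ) < n := Nat.cast_pos.2 (Nat.pos_of_ne_zero hn)
    positivity
  have hF (n : ℕ) : Integrable (F n) (volume.restrict (Ioi 1)) := by
    rcases eq_or_ne n 0 with rfl | hn
    · simp [F, h0]
    · exact (integrableOn_expTail_integrand (hpos hn)).const_mul _
  have hFle (n : ℕ) : ∫ t in Ioi (1 : ℝ), ‖F n t‖ ≤ C * N / π * (1 / (n : ℝ) ^ 2) := by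
    rcases eq_or_ne n 0 with rfl | hn
    · simp [F, h0]
    · simp only [F, norm_mul (c n), integral_const_mul]
      calc _ ≤ C * (1 / (π * n ^ 2 / N)) :=
            mul_le_mul (hc n) (integral_norm_expTail_integrand_le (hpos hn))
              (integral_nonneg fun _ ↦ norm_nonneg _) hC
        _ = _ := by
            have : (n : ℝ) ≠ 0 := Nat.cast_ne_zero.2 hn
            field_simp
  have hsum : Summable fun n ↦ ∫ t in Ioi (1 : ℝ), ‖F n t‖ :=
    Summable.of_nonneg_of_le (fun n ↦ integral_nonneg fun t ↦ norm_nonneg (F n t)) hFle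
      ((Real.summable_one_div_nat_pow.2 one_lt_two).mul_left _)
  have hint (n : ℕ) : ∫ t in Ioi (1 : ℝ), F n t = c n * expTailIntegral (π * n ^ 2 / N) := by
    simp only [F, integral_const_mul, expTailIntegral]
  constructor
  · refine Summable.of_nonneg_of_le (fun n ↦ norm_nonneg _) (fun n ↦ ?_) hsum
    rw [← hint]
    exact norm_integral_le_integral_norm _
  · have := hasSum_integral_of_summable_integral_norm hF hsum
    simp only [hint] at this
    suffices ∫ t in Ioi (1 : ℝ), (t : ℂ) ^ (-(3 / 4) : ℂ) * h t =
        ∫ t in Ioi (1 : ℝ), ∑' n, F n t by rwa [this]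
    refine setIntegral_congr_fun measurableSet_Ioi fun t ht ↦ ?_
    simp only [F]
    rw [← (hh t ht).tsum_eq, ← tsum_mul_left]
    exact tsum_congr fun n ↦ by ring

lemma mellin_eq_integral_Ioi_one_add {f g : ℝ → ℂ} {s k : ℂ} (hf : MellinConvergent f s)
    (hfg : ∀ t : ℝ, 0 < t → f t⁻¹ = (t : ℂ) ^ k * g t) :
    mellin f s = (∫ t in Ioi (1 : ℝ), (t : ℂ) ^ (s - 1) * f t) +
      ∫ t in Ioi (1 : ℝ), (t : ℂ) ^ (k - s - 1) * g t := by
  have hind (w : ℝ → ℂ) (S : Set ℝ) (hS : MeasurableSet S) (hS0 : S ⊆ Ioi 0) (z : ℂ) :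
      mellin (S.indicator w) z = ∫ t in S, (t : ℂ) ^ (z - 1) * w t := by
    have : (fun t : ℝ ↦ (t : ℂ) ^ (z - 1) • S.indicator w t) =
        S.indicator fun t : ℝ ↦ (t : ℂ) ^ (z - 1) * w t := by
      ext t
      by_cases ht : t ∈ S <;> simp [ht]
    rw [mellin, this, setIntegral_indicator hS, inter_eq_right.2 hS0]
  have hsmall : ∫ t in Ioo (0 : ℝ) 1, (t : ℂ) ^ (s - 1) * f t =
      ∫ t in Ioi (1 : ℝ), (t : ℂ) ^ (k - s - 1) * g t := by
    rw [← hind f _ measurableSet_Ioo (fun t ht ↦ ht.1),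
      ← hind g _ measurableSet_Ioi (fun t ht ↦ mem_Ioi.2 (one_pos.trans (mem_Ioi.1 ht)))]
    have h1 := mellin_comp_inv (fun t ↦ (Ioo (0 : ℝ) 1).indicator f t⁻¹) s
    simp only [inv_inv] at h1
    rw [h1, show k - s = -s + k by ring, ← mellin_cpow_smul]
    refine setIntegral_congr_fun measurableSet_Ioi fun t (ht : 0 < t) ↦ ?_
    simp only
    congr 1
    by_cases h : 1 < t
    · rw [indicator_of_mem (mem_Ioi.2 h),
        indicator_of_mem (mem_Ioo.2 ⟨inv_pos.2 ht, inv_lt_one_of_one_lt₀ h⟩), hfg t ht, smul_eq_mul]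
    · rw [indicator_of_notMem (notMem_Ioi.2 (not_lt.1 h)), smul_zero, indicator_of_notMem]
      exact fun h' ↦ h ((inv_lt_one₀ ht).1 h'.2)
  rw [mellin, ← Ioc_union_Ioi_eq_Ioi (zero_le_one (α := ℝ)), setIntegral_union
    (Ioc_disjoint_Ioi le_rfl) measurableSet_Ioi (hf.mono_set Ioc_subset_Ioi_self)
    (hf.mono_set (Ioi_subset_Ioi zero_le_one)), integral_Ioc_eq_integral_Ioo, add_comm]
  simp only [smul_eq_mul, hsmall]

namespace DirichletCharacter

open HurwitzZeta

lemma inv_apply_eq_conj {N : ℕ} (χ : DirichletCharacter ℂ N) (a : ZMod N) :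
    χ⁻¹ a = (starRingEnd ℂ) (χ a) := by
  rw [← MulChar.star_eq_inv, MulChar.star_apply, starRingEnd_apply]

variable {N : ℕ} [NeZero N] (χ : DirichletCharacter ℂ N)

/-- The theta series `∑ₙ χ(n) exp(-πn²x/N²)` over `n ∈ ℤ`, as a combination of even kernels. -/
noncomputable def thetaKernel (x : ℝ) : ℂ := ∑ j, χ j * evenKernel (ZMod.toAddCircle j) x

/-- The combination of cosine kernels dual to `thetaKernel`. -/
noncomputable def thetaCosKernel (x : ℝ) : ℂ := ∑ j, χ j * cosKernel (ZMod.toAddCircle j) x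

variable {χ}

lemma hasMellin_thetaKernel (h0 : χ 0 = 0) (hsum : ∑ j, χ j = 0) (heven : χ.Even) (s : ℂ) :
    HasMellin χ.thetaKernel (s / 2) (2 * N ^ s * completedLFunction χ s) := by
  let P (j : ZMod N) := hurwitzEvenFEPair (ZMod.toAddCircle j)
  have hP (j : ZMod N) : HasMellin (P j).f_modif (s / 2) ((P j).Λ₀ (s / 2)) :=
    ⟨((P j).isStrongFEPair_toStrongFEPair.hasMellin (s / 2)).1, rfl⟩
  have hint : Integrable (fun x : ℝ ↦ ∑ j, χ j * ((x : ℂ) ^ (s / 2 - 1) • (P j).f_modif x))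
      (volume.restrict (Ioi 0)) :=
    integrable_finsetSum _ fun j _ ↦ (hP j).1.const_mul _
  have hae : (fun x : ℝ ↦ ∑ j, χ j * ((x : ℂ) ^ (s / 2 - 1) • (P j).f_modif x))
      =ᵐ[volume.restrict (Ioi 0)] fun x : ℝ ↦ (x : ℂ) ^ (s / 2 - 1) • χ.thetaKernel x := by
    filter_upwards [ae_restrict_mem measurableSet_Ioi,
      ae_restrict_of_ae (compl_mem_ae_iff.2 (measure_singleton (1 : ℝ)))] with x hx hx1
    have hx0 : 0 < x := hx
    suffices ∑ j, χ j * (P j).f_modif x = χ.thetaKernel x by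
      rw [← this, smul_eq_mul, Finset.mul_sum]
      refine Finset.sum_congr rfl fun j _ ↦ ?_
      rw [smul_eq_mul]; ring
    rcases lt_or_gt_of_ne (show x ≠ 1 from hx1) with h | h
    · have (j : ZMod N) : (P j).f_modif x =
          evenKernel (ZMod.toAddCircle j) x - (x ^ (-(1 / 2) : ℝ) : ℝ) := by
        rw [WeakFEPair.f_modif, Pi.add_apply, indicator_of_notMem (notMem_Ioi.2 h.le),
          indicator_of_mem (mem_Ioo.2 ⟨hx0, h⟩)]
        simp [P, hurwitzEvenFEPair]
      simp only [this, mul_sub, Finset.sum_sub_distrib, ← Finset.sum_mul, hsum, thetaKernel]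
      simp
    · have (j : ZMod N) : (P j).f_modif x =
          evenKernel (ZMod.toAddCircle j) x - if j = 0 then 1 else 0 := by
        rw [WeakFEPair.f_modif, Pi.add_apply, indicator_of_mem (mem_Ioi.2 h),
          indicator_of_notMem fun h' ↦ lt_asymm h h'.2]
        simp [P, hurwitzEvenFEPair]
      simp only [this, mul_sub, Finset.sum_sub_distrib, thetaKernel]
      simp [h0]
  refine ⟨hint.congr hae, ?_⟩
  rw [mellin, ← integral_congr_ae hae, integral_finsetSum _ fun j _ ↦ (hP j).1.const_mul _,
    completedLFunction, ZMod.completedLFunction_def_even heven.to_fun]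
  have hN : (N : ℂ) ^ s * (N : ℂ) ^ (-s) = 1 := by
    rw [← cpow_add _ _ (Nat.cast_ne_zero.2 (NeZero.ne N)), add_neg_cancel, cpow_zero]
  have hL : ∑ j, χ j * completedHurwitzZetaEven (ZMod.toAddCircle j) s =
      (∑ j, χ j * (P j).Λ₀ (s / 2)) / 2 := by
    have hone : ∑ j, χ j * (1 / (1 - s)) = 0 := by rw [← Finset.sum_mul, hsum, zero_mul]
    have hzero (j : ZMod N) : χ j * ((if j = 0 then 1 else 0) / s) = 0 := by
      split_ifs with h <;> simp [h, h0]
    simp only [completedHurwitzZetaEven_eq, mul_sub, Finset.sum_sub_distrib, hone,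
      ZMod.toAddCircle_eq_zero, hzero, sub_zero]
    simp only [completedHurwitzZetaEven₀, ← mul_div_assoc, Finset.sum_div, P]
  rw [hL]
  have : ∑ j, χ j * (P j).Λ₀ (s / 2) =
      ∑ j, ∫ x : ℝ in Ioi 0, χ j * ((x : ℂ) ^ (s / 2 - 1) • (P j).f_modif x) := by
    refine Finset.sum_congr rfl fun j _ ↦ ?_
    rw [integral_const_mul, ← (hP j).2, mellin]
  rw [← this]
  linear_combination (- ∑ j, χ j * (P j).Λ₀ (s / 2)) * hN

lemma thetaKernel_eq (x : ℝ) :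
    χ.thetaKernel x = (1 / x ^ (1 / 2 : ℝ) : ℝ) * χ.thetaCosKernel (1 / x) := by
  simp only [thetaKernel, thetaCosKernel, Finset.mul_sum]
  refine Finset.sum_congr rfl fun j _ ↦ ?_
  rw [evenKernel_functional_equation, ofReal_mul]
  ring

lemma hasSum_nat_of_hasSum_int {f : ℤ → ℂ} {a : ℂ} (hf : HasSum f a) (h0 : f 0 = 0)
    (heven : ∀ n, f (-n) = f n) : HasSum (fun n : ℕ ↦ 2 * f n) a := by
  simpa [h0, heven, two_mul] using hf.nat_add_neg

lemma hasSum_thetaKernel (h0 : χ 0 = 0) (heven : χ.Even) {x : ℝ} (hx : 0 < x) :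
    HasSum (fun n : ℕ ↦ 2 * χ n * cexp (-(x * (π * n ^ 2 / N ^ 2 : ℝ)))) (χ.thetaKernel x) := by
  have hN : (N : ℝ) ≠ 0 := Nat.cast_ne_zero.2 (NeZero.ne N)
  have hint : HasSum (fun n : ℤ ↦ χ n * cexp (-(x * (π * n ^ 2 / N ^ 2 : ℝ))))
      (χ.thetaKernel x) := by
    have hj (j : ZMod N) : HasSum (fun n : ℤ ↦ if (n : ZMod N) = j then
        χ n * cexp (-(x * (π * n ^ 2 / N ^ 2 : ℝ))) else 0)
        (χ j * evenKernel (ZMod.toAddCircle j) x) := by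
      have hinj : Function.Injective fun m : ℤ ↦ N * m + (j.val : ℤ) := fun a b h ↦ by
        simpa [NeZero.ne N] using h
      rw [← hinj.hasSum_iff, ZMod.toAddCircle_apply]
      · refine ((hasSum_ofReal.2 (hasSum_int_evenKernel (j.val / N : ℝ) hx)).mul_left
          (χ j)).congr_fun fun m ↦ ?_
        have hcast : ((N * m + (j.val : ℤ) : ℤ) : ZMod N) = j := by simp
        simp only [Function.comp_apply, hcast, if_true]
        push_cast
        congr 2
        have hN' : (N : ℂ) ≠ 0 := Nat.cast_ne_zero.2 (NeZero.ne N)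
        field_simp
      · intro n hn
        rw [if_neg]
        rintro h
        apply hn
        have : ((N : ℕ) : ℤ) ∣ n - j.val := by
          rw [← ZMod.intCast_zmod_eq_zero_iff_dvd]
          simp [h]
        obtain ⟨m, hm⟩ := this
        exact ⟨m, by simp only; linarith⟩
    simpa [thetaKernel] using hasSum_sum (s := Finset.univ) fun j _ ↦ hj j
  have := hasSum_nat_of_hasSum_int hint (by simp [h0]) fun n ↦ by
    push_cast
    rw [heven.eval_neg, neg_sq]
  simpa [mul_assoc] using this

lemma gaussTau_eq_gaussSum : gaussTau χ = gaussSum χ ZMod.stdAddChar := by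
  have (j : ℕ) : ZMod.stdAddChar (j : ZMod N) = eC (j / N) := by
    have := ZMod.stdAddChar_coe (N := N) j
    rw [Int.cast_natCast] at this
    rw [this, eC]
    push_cast
    congr 1
    ring
  rw [gaussTau, gaussSum]
  refine Finset.sum_bij' (fun a _ ↦ (a : ZMod N)) (fun j _ ↦ j.val) ?_ ?_ ?_ ?_ ?_
  · simp
  · simp [ZMod.val_lt]
  · intro a ha; exact ZMod.val_cast_of_lt (Finset.mem_range.1 ha)
  · simp
  · intro a _; rw [this]

lemma hasSum_thetaCosKernel (hprim : χ.IsPrimitive) (h0 : χ 0 = 0) (heven : χ.Even) {x : ℝ}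
    (hx : 0 < x) :
    HasSum (fun n : ℕ ↦ 2 * (gaussTau χ * (starRingEnd ℂ) (χ n)) * cexp (-(x * (π * n ^ 2 : ℝ))))
      (χ.thetaCosKernel x) := by
  have hint : HasSum (fun n : ℤ ↦ gaussTau χ * (starRingEnd ℂ) (χ n) *
      cexp (-(x * (π * n ^ 2 : ℝ)))) (χ.thetaCosKernel x) := by
    have hj (j : ZMod N) : HasSum (fun n : ℤ ↦ χ j * ZMod.stdAddChar ((n : ZMod N) * j) *
        cexp (-(x * (π * n ^ 2 : ℝ)))) (χ j * cosKernel (ZMod.toAddCircle j) x) := by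
      rw [ZMod.toAddCircle_apply]
      refine ((hasSum_int_cosKernel (j.val / N : ℝ) hx).mul_left (χ j)).congr_fun fun n ↦ ?_
      have hn : (n : ZMod N) * j = ((n * j.val : ℤ) : ZMod N) := by simp
      rw [hn, ZMod.stdAddChar_coe, mul_assoc]
      push_cast
      congr 3 <;> ring
    have hs := hasSum_sum (s := Finset.univ) fun j _ ↦ hj j
    refine hs.congr_fun fun n ↦ ?_
    rw [← Finset.sum_mul, gaussTau_eq_gaussSum, ← inv_apply_eq_conj, mul_comm (gaussSum _ _),
      ← gaussSum_mulShift_of_isPrimitive _ hprim]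
    simp [gaussSum, AddChar.mulShift_apply]
  have := hasSum_nat_of_hasSum_int hint (by simp [h0]) fun n ↦ by
    push_cast
    rw [heven.eval_neg, neg_sq]
  simpa [mul_assoc] using this

end DirichletCharacter

open DirichletCharacter in
/-- Let `χ` be an even primitive Dirichlet character of modulus `N > 1`. Then
`L(1/2,χ) = Σ_{n≥1} n^{−1/2}·(χ(n) + (τ(χ)/√N)·χ̄(n))·ω₁(n√(π/N))`, the series converging
absolutely. -/
theorem stmt_12 (N : ℕ) [NeZero N] (hN : 1 < N) (χ : DirichletCharacter ℂ N)
    (hprim : χ.IsPrimitive) (heven : χ.Even) :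
    Summable (fun n : ℕ => ‖(n : ℂ) ^ (-(1 / 2) : ℂ) *
        (χ (n : ZMod N) + gaussTau χ / (Real.sqrt N : ℂ) * (starRingEnd ℂ) (χ (n : ZMod N))) *
        omegaJ 1 (n * Real.sqrt (Real.pi / N))‖) ∧
    χ.LFunction (1 / 2) =
      ∑' n : ℕ, (n : ℂ) ^ (-(1 / 2) : ℂ) *
        (χ (n : ZMod N) + gaussTau χ / (Real.sqrt N : ℂ) * (starRingEnd ℂ) (χ (n : ZMod N))) *
        omegaJ 1 (n * Real.sqrt (Real.pi / N)) := by
  have hNpos : (0 : ℝ) < N := Nat.cast_pos.2 (by omega)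
  have hNC : (N : ℂ) ≠ 0 := Nat.cast_ne_zero.2 (by omega)
  have h0 : χ 0 = 0 := χ.map_zero' (by omega)
  have hne : χ ≠ 1 := by
    rintro rfl
    have : (1 : DirichletCharacter ℂ N).conductor = N := hprim
    rw [conductor_one] at this
    omega
  have hsum : ∑ j, χ j = 0 := MulChar.sum_eq_zero_of_ne_one hne
  set c : ℕ → ℂ := fun n ↦ χ (n : ZMod N) +
    gaussTau χ / (Real.sqrt N : ℂ) * (starRingEnd ℂ) (χ (n : ZMod N)) with hc
  have hc0 : c 0 = 0 := by simp [hc, h0]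
  have hχle (n : ℕ) : ‖χ (n : ZMod N)‖ ≤ 1 := χ.norm_le_one _
  set H : ℝ → ℂ := fun t ↦ χ.thetaKernel (N * t) with hH
  set K : ℝ → ℂ := fun t ↦ ((Real.sqrt N : ℂ))⁻¹ * χ.thetaCosKernel (t / N) with hK
  have hHsum (t : ℝ) (ht : 1 < t) :
      HasSum (fun n : ℕ ↦ 2 * χ n * cexp (-(t * (π * n ^ 2 / N : ℝ)))) (H t) := by
    convert hasSum_thetaKernel h0 heven (x := N * t) (by positivity) using 5 with n
    push_cast
    field_simp
  have hKsum (t : ℝ) (ht : 1 < t) : HasSum (fun n : ℕ ↦ 2 * (gaussTau χ / (Real.sqrt N : ℂ) *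
      (starRingEnd ℂ) (χ n)) * cexp (-(t * (π * n ^ 2 / N : ℝ)))) (K t) := by
    refine ((hasSum_thetaCosKernel hprim h0 heven (x := t / N)
      (by positivity)).mul_left ((Real.sqrt N : ℂ))⁻¹).congr_fun fun n ↦ ?_
    have : -(t * (π * n ^ 2 / N : ℝ) : ℂ) = -((t / N : ℝ) * (π * n ^ 2 : ℝ)) := by
      push_cast; ring
    rw [this]
    ring
  have h1 := hasSum_mul_expTailIntegral (NeZero.pos N) (c := fun n ↦ 2 * χ n) (C := 2)
    (fun n ↦ by simpa using hχle n) (by simp [h0]) hHsum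
  have h2 := hasSum_mul_expTailIntegral (NeZero.pos N)
    (c := fun n ↦ 2 * (gaussTau χ / (Real.sqrt N : ℂ) * (starRingEnd ℂ) (χ n)))
    (C := 2 * ‖gaussTau χ / (Real.sqrt N : ℂ)‖)
    (fun n ↦ by
      rw [norm_mul, norm_mul, RCLike.norm_conj, norm_ofNat]
      gcongr
      exact mul_le_of_le_one_right (norm_nonneg _) (hχle n))
    (by simp [h0]) hKsum
  have hFE (t : ℝ) (ht : 0 < t) : H t⁻¹ = (t : ℂ) ^ (1 / 2 : ℂ) * K t := by
    simp only [hH, hK]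
    rw [thetaKernel_eq, ← mul_assoc, show 1 / (N * t⁻¹) = t / N by field_simp]
    congr 1
    have : (1 / 2 : ℂ) = ((1 / 2 : ℝ) : ℂ) := by push_cast; rfl
    rw [this, ← ofReal_cpow ht.le, Real.mul_rpow hNpos.le (by positivity), Real.inv_rpow ht.le,
      ← Real.sqrt_eq_rpow]
    push_cast
    rw [one_div, mul_inv, inv_inv, mul_comm]
  have hmel := hasMellin_thetaKernel h0 hsum heven (1 / 2)
  have hHconv : MellinConvergent H (1 / 2 / 2) := (MellinConvergent.comp_mul_left hNpos).2 hmel.1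
  have hval : mellin H (1 / 2 / 2) = (N : ℂ) ^ (-(1 / 4) : ℂ) *
      (2 * N ^ (1 / 2 : ℂ) * completedLFunction χ (1 / 2)) := by
    rw [hH, mellin_comp_mul_left _ _ hNpos, hmel.2, smul_eq_mul, ofReal_natCast]
    norm_num
  have hsplit := mellin_eq_integral_Ioi_one_add hHconv hFE
  rw [show (1 / 2 / 2 - 1 : ℂ) = -(3 / 4) by norm_num,
    show (1 / 2 - 1 / 2 / 2 - 1 : ℂ) = -(3 / 4) by norm_num] at hsplit
  have htotal := h1.2.add h2.2
  rw [← hsplit] at htotal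
  have habs : Summable fun n : ℕ ↦ ‖2 * c n * expTailIntegral (π * n ^ 2 / N)‖ := by
    refine Summable.of_nonneg_of_le (fun n ↦ norm_nonneg _) (fun n ↦ ?_) (h1.1.add h2.1)
    refine (le_of_eq ?_).trans (norm_add_le _ _)
    congr 1
    simp only [hc]
    ring
  set A : ℂ := (((π / N) ^ (1 / 4 : ℝ) : ℝ) : ℂ) / (2 * Gamma (1 / 4)) with hA
  have hterm (n : ℕ) : (n : ℂ) ^ (-(1 / 2) : ℂ) * c n * omegaJ 1 (n * Real.sqrt (π / N)) =
      A * (2 * c n * expTailIntegral (π * n ^ 2 / N)) := by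
    rcases eq_or_ne n 0 with rfl | hn
    · simp [hc0]
    have hn' : (0 : ℝ) < n := Nat.cast_pos.2 (Nat.pos_of_ne_zero hn)
    have hnC : (n : ℂ) ≠ 0 := Nat.cast_ne_zero.2 hn
    rw [omegaJ_one_eq (by positivity), mul_pow, Real.sq_sqrt (by positivity),
      show (n : ℝ) ^ 2 * (π / N) = π * n ^ 2 / N by ring]
    have hpow : (((n : ℝ) * Real.sqrt (π / N) : ℝ) : ℂ) ^ (1 / 2 : ℂ) =
        (n : ℂ) ^ (1 / 2 : ℂ) * (((π / N) ^ (1 / 4 : ℝ) : ℝ) : ℂ) := by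
      have : (1 / 2 : ℂ) = ((1 / 2 : ℝ) : ℂ) := by push_cast; rfl
      rw [this, ← ofReal_cpow (by positivity), Real.mul_rpow hn'.le (Real.sqrt_nonneg _),
        Real.sqrt_eq_rpow, ← Real.rpow_mul (by positivity), ofReal_mul, ofReal_cpow hn'.le]
      norm_num
    have hcancel : (n : ℂ) ^ (-(1 / 2) : ℂ) * (n : ℂ) ^ (1 / 2 : ℂ) = 1 := by
      rw [← cpow_add _ _ hnC, neg_add_cancel, cpow_zero]
    rw [hpow, hA]
    linear_combination (c n * (((π / N) ^ (1 / 4 : ℝ) : ℝ) : ℂ) *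
      expTailIntegral (π * n ^ 2 / N) / Gamma (1 / 4)) * hcancel
  have hL : χ.LFunction (1 / 2) = A * mellin H (1 / 2 / 2) := by
    rw [LFunction_eq_completed_div_gammaFactor χ _ (by left; norm_num), heven.gammaFactor_def,
      Gammaℝ_def, hval, hA, Real.div_rpow Real.pi_pos.le hNpos.le, ofReal_div,
      ofReal_cpow Real.pi_pos.le, ofReal_cpow hNpos.le]
    have hG : Gamma (1 / 4) ≠ 0 := Gamma_ne_zero_of_re_pos (by norm_num)
    have hpi : (π : ℂ) ≠ 0 := ofReal_ne_zero.2 Real.pi_ne_zero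
    have e1 : (N : ℂ) ^ (1 / 2 : ℂ) = (N : ℂ) ^ (1 / 4 : ℂ) * (N : ℂ) ^ (1 / 4 : ℂ) := by
      rw [← cpow_add _ _ hNC]; norm_num
    have hN4 : (N : ℂ) ^ (1 / 4 : ℂ) ≠ 0 := by simp [cpow_eq_zero_iff, hNC]
    have hpi4 : (π : ℂ) ^ (1 / 4 : ℂ) ≠ 0 := by simp [cpow_eq_zero_iff, hpi]
    rw [e1, cpow_neg, show (-(1 / 2) / 2 : ℂ) = -(1 / 4) by norm_num, cpow_neg,
      show (1 / 2 / 2 : ℂ) = 1 / 4 by norm_num]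
    push_cast
    field_simp
  change (Summable fun n : ℕ ↦ ‖(n : ℂ) ^ (-(1 / 2) : ℂ) * c n * omegaJ 1 (n * √(π / N))‖) ∧
    _ = ∑' n : ℕ, (n : ℂ) ^ (-(1 / 2) : ℂ) * c n * omegaJ 1 (n * √(π / N))
  constructor
  · simp only [hterm, norm_mul A]
    exact habs.mul_left _
  · simp only [hterm]
    rw [hL, tsum_mul_left, ← htotal.tsum_eq]
    congr 1
    refine tsum_congr fun n ↦ ?_
    simp only [hc]
    ring
end

section
/- For all complex numbers x and y with x²y ≠ 1 and every natural number γ, one has 1 + (1 − y) · Σ_{β=1}^{γ} y^β · Σ_{δ=0}^{2β} x^δ + y^{γ+1} · Σ_{β=0}^{2γ+1} x^β = y + ( (1 + xy) / (1 − x²y) ) · ( 1 − (x²y)^{γ+1} ). -/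
/-- For all complex `x`, `y` with `x²y ≠ 1` and every natural `γ`,
`1 + (1 − y)·Σ_{β=1}^{γ} y^β·Σ_{δ=0}^{2β} x^δ + y^{γ+1}·Σ_{β=0}^{2γ+1} x^β
  = y + ((1 + xy)/(1 − x²y))·(1 − (x²y)^{γ+1})`. -/
theorem stmt_16 (x y : ℂ) (hxy : x ^ 2 * y ≠ 1) (γ : ℕ) :
    1 + (1 - y) * (∑ β ∈ Finset.Icc 1 γ, y ^ β * ∑ δ ∈ Finset.range (2 * β + 1), x ^ δ)
      + y ^ (γ + 1) * ∑ β ∈ Finset.range (2 * γ + 2), x ^ β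
    = y + ((1 + x * y) / (1 - x ^ 2 * y)) * (1 - (x ^ 2 * y) ^ (γ + 1)) := by
  have h : 1 - x ^ 2 * y ≠ 0 := sub_ne_zero.mpr hxy.symm
  induction γ with
  | zero =>
    simp only [Finset.sum_range_succ, Finset.range_zero, Finset.sum_empty, zero_add, mul_zero,
      Finset.Icc_eq_empty_of_lt zero_lt_one, pow_one, div_mul_cancel₀ _ h]
    ring
  | succ n ih =>
    have step : ((1 + x * y) / (1 - x ^ 2 * y)) * (1 - (x ^ 2 * y) ^ (n + 1 + 1))
        = ((1 + x * y) / (1 - x ^ 2 * y)) * (1 - (x ^ 2 * y) ^ (n + 1))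
          + (1 + x * y) * (x ^ 2 * y) ^ (n + 1) := by
      field_simp
      ring
    rw [step, ← add_assoc, ← ih, Finset.sum_Icc_succ_top (by lia),
      show 2 * (n + 1) + 2 = 2 * n + 2 + 1 + 1 by ring,
      show 2 * (n + 1) + 1 = 2 * n + 2 + 1 by ring]
    simp only [Finset.sum_range_succ _ (2 * n + 2), Finset.sum_range_succ _ (2 * n + 2 + 1)]
    ring
end
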